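/- arXiv:1811.02739 — 4 statements merged into one kernel-verified Lean document; each statement's English description precedes it below -/
import Mathlib

section
/- Let p be an odd prime and λ ∈ F_p with λ ≠ 0 and λ ≠ -1. Then #{(v,z_0,z_1,z_2) ∈ F_p^4 : (z_0,z_1,z_2) ≠ (0,0,0) and v^2 = (λ+1)·z_0·z_1·z_2·(λ·z_0+z_1)·(z_1+z_2)·(z_0+z_2)} = (p−1)·(p^2 + 1 + a_{λ,p}^2). -/
section K3aux
open Finset

variable {F : Type*} [Field F] [Fintype F] [DecidableEq F]

local notation "χ" => quadraticChar F

lemma k3_sum_affine {M : Type*} [AddCommMonoid M] (g : F → M) (a b : F) (ha : a ≠ 0) :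
    ∑ x, g (a * x + b) = ∑ x, g x := by
  have := Equiv.sum_comp ((Equiv.mulLeft₀ a ha).trans (Equiv.addRight b)) g
  simpa using this

lemma k3_sum_chi (hF : ringChar F ≠ 2) : ∑ x : F, χ x = 0 :=
  quadraticChar_sum_zero hF

lemma k3_chi_lin (hF : ringChar F ≠ 2) (a b : F) (ha : a ≠ 0) : ∑ x : F, χ (a * x + b) = 0 := by
  rw [k3_sum_affine (fun x => χ x) a b ha]
  exact k3_sum_chi hF

lemma k3_card_sq (hF : ringChar F ≠ 2) (y : F) :
    ∑ x : F, (if x ^ 2 = y then (1 : ℤ) else 0) = 1 + χ y := by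
  have h := quadraticChar_card_sqrts hF y
  rw [add_comm, ← h, Finset.sum_boole]
  congr 2
  ext x
  simp

lemma k3_sum_sq (hF : ringChar F ≠ 2) (h : F → ℤ) :
    ∑ x : F, h (x ^ 2) = ∑ y : F, h y * (1 + χ y) := by
  simp_rw [← k3_card_sq hF, Finset.mul_sum]
  rw [Finset.sum_comm]
  refine Finset.sum_congr rfl fun x _ => ?_
  simp

lemma k3_two (hF : ringChar F ≠ 2) : (2 : F) ≠ 0 := Ring.two_ne_zero hF

lemma k3_sum_quad (hF : ringChar F ≠ 2) (g : F → ℤ) (a b : F) (ha : a ≠ 0) :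
    ∑ x : F, g (a * x ^ 2 + b * x) = ∑ T : F, g T * (1 + χ (b ^ 2 + 4 * a * T)) := by
  have h2 := k3_two hF
  have h4a : 4 * a ≠ 0 := by
    have : (4 : F) = 2 * 2 := by norm_num
    rw [this]; positivity
  have h2a : 2 * a ≠ 0 := mul_ne_zero h2 ha
  have e1 := k3_sum_affine (fun w => g ((w ^ 2 - b ^ 2) / (4 * a))) (2 * a) b h2a
  have e2 := k3_sum_sq hF (fun y => g ((y - b ^ 2) / (4 * a)))
  have e3 := k3_sum_affine (fun y => g ((y - b ^ 2) / (4 * a)) * (1 + χ y)) (4 * a) (b ^ 2) h4a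
  rw [← e1] at e2
  rw [← e3] at e2
  convert e2 using 2 with x _ x _
  · congr 1
    rw [eq_div_iff h4a]; ring
  · congr 2
    · rw [eq_div_iff h4a]; ring
    · congr 1; ring

lemma k3_sq (x : F) (hx : x ≠ 0) : χ (x ^ 2) = 1 := quadraticChar_sq_one' hx

lemma k3_sq_mul (x y : F) (hx : x ≠ 0) : χ (x ^ 2 * y) = χ y := by
  rw [map_mul, k3_sq x hx, one_mul]

lemma k3_chi_prod (hF : ringChar F ≠ 2) (c : F) (hc : c ≠ 0) :
    ∑ x : F, χ (x * (x + c)) = -1 := by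
  have h1 : ∀ x : F, χ (x * (x + c)) = (if x = 0 then 0 else χ (1 + c * x⁻¹)) := by
    intro x
    split_ifs with h
    · simp [h]
    · rw [← k3_sq_mul x (1 + c * x⁻¹) h]
      congr 1
      field_simp
  have h2 : ∀ x : F, (if x = 0 then 0 else χ (1 + c * x⁻¹)) = χ (c * x⁻¹ + 1)
      - (if x = 0 then 1 else 0) := by
    intro x
    split_ifs with h
    · simp [h]
    · simp [add_comm]
  simp_rw [h1, h2]
  rw [Finset.sum_sub_distrib]
  have h3 := Equiv.sum_comp (Equiv.inv F) (fun x => χ (c * x + 1))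
  simp only [Equiv.inv_apply] at h3
  rw [h3, k3_chi_lin hF c 1 hc]
  simp

lemma k3_chi_sq_sub (hF : ringChar F ≠ 2) (d : F) (hd : d ≠ 0) :
    ∑ x : F, χ (x ^ 2 - d) = -1 := by
  rw [k3_sum_sq hF (fun y => χ (y - d))]
  have : ∀ y : F, χ (y - d) * (1 + χ y) = χ (1 * y + (-d)) + χ (y * (y + (-d))) := by
    intro y
    rw [map_mul, one_mul, sub_eq_add_neg]; ring
  simp_rw [this]
  rw [Finset.sum_add_distrib, k3_chi_lin hF _ _ one_ne_zero, k3_chi_prod hF _ (neg_ne_zero.2 hd)]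
  simp

/-- complete square: `a * q(v) = (a v + b)^2 - d` -/
lemma k3_chi_quad (hF : ringChar F ≠ 2) (a b d : F) (ha : a ≠ 0) (q : F → F)
    (hq : ∀ v, a * q v = (a * v + b) ^ 2 - d) :
    ∑ v : F, χ (q v) = χ a * (if d = 0 then (Fintype.card F : ℤ) - 1 else -1) := by
  have h1 : ∀ v, χ (q v) = χ a * χ ((a * v + b) ^ 2 - d) := by
    intro v
    rw [← hq, ← map_mul, ← mul_assoc, ← pow_two, k3_sq_mul _ _ ha]
  simp_rw [h1]
  rw [← Finset.mul_sum, k3_sum_affine (fun w => χ (w ^ 2 - d)) a b ha]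
  congr 1
  split_ifs with h
  · subst h
    have : ∀ x : F, χ (x ^ 2 - 0) = 1 - (if x = 0 then 1 else 0) := by
      intro x
      split_ifs with h
      · simp [h]
      · rw [sub_zero, k3_sq x h]; simp
    simp_rw [this]
    rw [Finset.sum_sub_distrib]
    simp
  · exact k3_chi_sq_sub hF d h

lemma k3_sum_inv (hF : ringChar F ≠ 2) (g : F → ℤ) (D : F) (hD : D ≠ 0) :
    ∑ x : F, (if x = 0 then 0 else g (x + D / x)) = ∑ T : F, g T * (1 + χ (T ^ 2 - 4 * D)) := by
  have h1 : ∀ T : F, (1 + χ (T ^ 2 - 4 * D)) =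
      ∑ x : F, (if x ^ 2 - T * x = -D then (1 : ℤ) else 0) := by
    intro T
    have := k3_sum_quad hF (fun y => if y = -D then (1 : ℤ) else 0) 1 (-T) one_ne_zero
    have e : ∀ x : F, 1 * x ^ 2 + -T * x = x ^ 2 - T * x := fun x => by ring
    simp only [e] at this
    rw [this]
    simp only [ite_mul, one_mul, zero_mul, Finset.sum_ite_eq', Finset.mem_univ, if_true]
    congr 2
    ring
  simp_rw [h1, Finset.mul_sum]
  rw [Finset.sum_comm]
  refine Finset.sum_congr rfl fun x _ => ?_
  split_ifs with h
  · subst h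
    symm
    apply Finset.sum_eq_zero
    intro T _
    rw [if_neg]
    · simp
    · intro h
      apply hD
      simpa using h.symm
  · have : ∀ T : F, (x ^ 2 - T * x = -D) ↔ (T = x + D / x) := by
      intro T
      constructor
      · intro h'
        field_simp
        linear_combination -h'
      · rintro rfl
        field_simp
        ring
    simp [this]

lemma k3_sum_symm (hF : ringChar F ≠ 2) (g : F → F → ℤ) :
    ∑ s : F, ∑ t : F, g (s + t) (s * t) =
      ∑ u : F, ∑ v : F, g u v * (1 + χ (u ^ 2 - 4 * v)) := by
  have h1 : ∀ s : F, ∑ t : F, g (s + t) (s * t) = ∑ u : F, g u (s * (u - s)) := by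
    intro s
    have := k3_sum_affine (fun u => g u (s * (u - s))) 1 s one_ne_zero
    rw [← this]
    refine Finset.sum_congr rfl fun t _ => ?_
    congr 1 <;> ring
  simp_rw [h1]
  rw [Finset.sum_comm]
  refine Finset.sum_congr rfl fun u _ => ?_
  have := k3_sum_quad hF (g u) (-1) u (by simp)
  convert this using 2 with x _ x _
  · congr 1; ring
  · congr 3; ring


lemma k3_S1 (hF : ringChar F ≠ 2) (m : F) (hm : m ≠ 0) :
    ∑ x : F, χ (x ^ 3 - 2 * x ^ 2 + m * x) = χ 2 * ∑ s : F, χ ((s - 1) * (s ^ 2 - m)) := by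
  have h2 := k3_two hF
  have e1 := k3_sum_inv hF (fun T => χ (T - 2)) m hm
  have e2 : ∀ x : F, χ (x ^ 3 - 2 * x ^ 2 + m * x) = if x = 0 then 0 else χ (x + m / x - 2) := by
    intro x
    split_ifs with h
    · simp [h]
    · rw [← k3_sq_mul x (x + m / x - 2) h]
      congr 1
      field_simp
      ring
  simp_rw [e2]
  rw [e1]
  have e3 : ∀ T : F, χ (T - 2) * (1 + χ (T ^ 2 - 4 * m)) =
      χ (1 * T + (-2)) + χ ((T - 2) * (T ^ 2 - 4 * m)) := by
    intro T
    rw [map_mul, one_mul, sub_eq_add_neg]; ring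
  simp_rw [e3]
  rw [Finset.sum_add_distrib, k3_chi_lin hF _ _ one_ne_zero, zero_add,
    ← k3_sum_affine (fun T => χ ((T - 2) * (T ^ 2 - 4 * m))) 2 0 h2, Finset.mul_sum]
  refine Finset.sum_congr rfl fun s _ => ?_
  rw [← map_mul, ← k3_sq_mul 2 (2 * ((s - 1) * (s ^ 2 - m))) h2]
  congr 1
  ring

lemma k3_S2 (hF : ringChar F ≠ 2) (m : F) (hm : m ≠ 0) (hm1 : m ≠ 1) :
    (∑ s : F, χ ((s - 1) * (s ^ 2 - m))) ^ 2 = Fintype.card F +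
      ∑ u : F, ∑ v : F, χ ((v - u + 1) * ((v + m) ^ 2 - m * u ^ 2) * (u ^ 2 - 4 * v)) := by
  have hn : 1 - m ≠ 0 := sub_ne_zero.2 (Ne.symm hm1)
  have e1 := k3_sum_symm hF (fun u v => χ ((v - u + 1) * ((v + m) ^ 2 - m * u ^ 2)))
  have e2 : (∑ s : F, χ ((s - 1) * (s ^ 2 - m))) ^ 2 = ∑ s : F, ∑ t : F,
      χ ((s * t - (s + t) + 1) * ((s * t + m) ^ 2 - m * (s + t) ^ 2)) := by
    rw [pow_two, Finset.sum_mul_sum]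
    refine Finset.sum_congr rfl fun s _ => Finset.sum_congr rfl fun t _ => ?_
    rw [← map_mul]
    congr 1
    ring
  rw [e2, e1]
  simp_rw [mul_add, mul_one, Finset.sum_add_distrib, ← map_mul]
  congr 1
  have e3 : ∀ v : F, ∑ u : F, χ ((v - u + 1) * ((v + m) ^ 2 - m * u ^ 2)) =
      ∑ w : F, χ (w * ((v + m) ^ 2 - m * (v + 1 - w) ^ 2)) := by
    intro v
    rw [← k3_sum_affine (fun w => χ (w * ((v + m) ^ 2 - m * (v + 1 - w) ^ 2))) (-1) (v + 1)
      (by simp)]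
    refine Finset.sum_congr rfl fun u _ => ?_
    congr 1
    ring
  rw [Finset.sum_comm]
  simp_rw [e3]
  rw [Finset.sum_comm]
  have e4 : ∀ w : F, ∑ v : F, χ (w * ((v + m) ^ 2 - m * (v + 1 - w) ^ 2)) =
      χ (1 - m) * (Fintype.card F * (if w = 1 - m then χ w else 0) - χ w) := by
    intro w
    simp_rw [map_mul]
    rw [← Finset.mul_sum, k3_chi_quad hF (1 - m) (m * w) (m * (w - (1 - m)) ^ 2) hn
      (fun v => (v + m) ^ 2 - m * (v + 1 - w) ^ 2) (fun v => by ring)]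
    have : m * (w - (1 - m)) ^ 2 = 0 ↔ w = 1 - m := by
      simp [hm, sub_eq_zero]
    simp only [this]
    split_ifs <;> ring
  simp_rw [e4]
  rw [← Finset.mul_sum, Finset.sum_sub_distrib, k3_sum_chi hF, ← Finset.mul_sum]
  simp only [Finset.sum_ite_eq', Finset.mem_univ, if_true]
  have : χ (1 - m) * χ (1 - m) = 1 := by rw [← map_mul, ← pow_two, k3_sq _ hn]
  linear_combination (Fintype.card F : ℤ) * this

lemma k3_S3 (hF : ringChar F ≠ 2) (m : F) (hm : m ≠ 0) :
    ∑ u : F, ∑ v : F, χ ((v - u + 1) * ((v + m) ^ 2 - m * u ^ 2) * (u ^ 2 - 4 * v)) =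
    - χ (-1) + ∑ t : F, ∑ u : F,
      χ ((t ^ 2 - m) * ((t - 1) * u + (1 - m)) * (u ^ 2 - 4 * t * u + 4 * m)) := by
  have h2 := k3_two hF
  have e1 : ∀ u : F,
      ∑ v : F, χ ((v - u + 1) * ((v + m) ^ 2 - m * u ^ 2) * (u ^ 2 - 4 * v)) =
      ∑ t : F, χ ((t ^ 2 - m) * ((t - 1) * u + (1 - m)) * (u ^ 2 - 4 * t * u + 4 * m)) -
      (if u = 0 then χ (-1) else 0) := by
    intro u
    split_ifs with hu
    · subst hu
      have a1 : ∀ v : F, χ ((v - 0 + 1) * ((v + m) ^ 2 - m * 0 ^ 2) * (0 ^ 2 - 4 * v)) =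
          χ (-1) * χ (v * (v + 1)) - (if v = -m then χ (m * (1 - m)) else 0) := by
        intro v
        split_ifs with hv
        · subst hv
          rw [← map_mul]
          have : (-1 : F) * (-m * (-m + 1)) = m * (1 - m) := by ring
          rw [this]; simp
        · have hv' : v + m ≠ 0 := fun h => hv (eq_neg_of_add_eq_zero_left h)
          rw [← map_mul, ← k3_sq_mul (2 * (v + m)) (-1 * (v * (v + 1))) (mul_ne_zero h2 hv'),
            sub_zero]
          congr 1
          ring
      have a2 : ∀ t : F, χ ((t ^ 2 - m) * ((t - 1) * 0 + (1 - m)) *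
          (0 ^ 2 - 4 * t * 0 + 4 * m)) = χ (m * (1 - m)) * χ (t ^ 2 - m) := by
        intro t
        rw [← map_mul, ← k3_sq_mul 2 (m * (1 - m) * (t ^ 2 - m)) h2]
        congr 1
        ring
      simp_rw [a1, a2]
      rw [Finset.sum_sub_distrib, ← Finset.mul_sum, ← Finset.mul_sum, k3_chi_prod hF 1 one_ne_zero,
        k3_chi_sq_sub hF m hm]
      simp
      ring
    · rw [sub_zero, ← k3_sum_affine (fun v =>
        χ ((v - u + 1) * ((v + m) ^ 2 - m * u ^ 2) * (u ^ 2 - 4 * v))) u (-m) hu]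
      refine Finset.sum_congr rfl fun t _ => ?_
      rw [← k3_sq_mul u ((t ^ 2 - m) * ((t - 1) * u + (1 - m)) * (u ^ 2 - 4 * t * u + 4 * m)) hu]
      congr 1
      ring
  simp_rw [e1]
  rw [Finset.sum_sub_distrib, Finset.sum_comm]
  simp
  ring

lemma k3_S4 (hF : ringChar F ≠ 2) (m : F) (hm1 : m ≠ 1) :
    ∑ t : F, ∑ u : F,
      χ ((t ^ 2 - m) * ((t - 1) * u + (1 - m)) * (u ^ 2 - 4 * t * u + 4 * m)) =
    -1 + χ (-1) + ∑ k : F, ∑ z : F,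
      χ (z * (z + 1) * (1 + ((1 - m) * k ^ 2 + 2 * k)) *
        (z + (1 + ((1 - m) * k ^ 2 + 2 * k)))) := by
  have h2 := k3_two hF
  have hn : 1 - m ≠ 0 := sub_ne_zero.2 (Ne.symm hm1)
  rw [← k3_sum_affine (fun t : F => ∑ u : F,
      χ ((t ^ 2 - m) * ((t - 1) * u + (1 - m)) * (u ^ 2 - 4 * t * u + 4 * m))) 1 1 one_ne_zero]
  rw [← Equiv.sum_comp (Equiv.inv F)]
  simp only [Equiv.inv_apply]
  have e1 : ∀ k : F, ∑ u : F, χ (((1 * k⁻¹ + 1) ^ 2 - m) * (((1 * k⁻¹ + 1) - 1) * u + (1 - m)) *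
      (u ^ 2 - 4 * (1 * k⁻¹ + 1) * u + 4 * m)) =
      (if k = 0 then -1 + χ (-1) else 0) + ∑ z : F,
      χ (z * (z + 1) * (1 + ((1 - m) * k ^ 2 + 2 * k)) *
        (z + (1 + ((1 - m) * k ^ 2 + 2 * k)))) := by
    intro k
    split_ifs with hk
    · subst hk
      have a1 : ∀ z : F, χ (z * (z + 1) * (1 + ((1 - m) * 0 ^ 2 + 2 * 0)) *
        (z + (1 + ((1 - m) * 0 ^ 2 + 2 * 0)))) = χ z - (if z = -1 then χ (-1) else 0) := by
        intro z
        split_ifs with hz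
        · subst hz; simp
        · have hz' : z + 1 ≠ 0 := fun h => hz (eq_neg_of_add_eq_zero_left h)
          rw [← k3_sq_mul (z + 1) z hz', sub_zero]
          congr 1
          ring
      simp_rw [a1]
      rw [Finset.sum_sub_distrib, k3_sum_chi hF]
      have a2 : ∀ u : F, χ (((1 * 0⁻¹ + 1) ^ 2 - m) * (((1 * 0⁻¹ + 1) - 1) * u + (1 - m)) *
          (u ^ 2 - 4 * (1 * 0⁻¹ + 1) * u + 4 * m)) = χ (u ^ 2 - 4 * u + 4 * m) := by
        intro u
        rw [← k3_sq_mul (1 - m) (u ^ 2 - 4 * u + 4 * m) hn, inv_zero]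
        congr 1
        ring
      simp_rw [a2]
      rw [k3_chi_quad hF 1 (-2) (4 * (1 - m)) one_ne_zero
        (fun u => u ^ 2 - 4 * u + 4 * m) (fun u => by ring)]
      have : 4 * (1 - m) ≠ 0 := by
        have h4 : (4 : F) = 2 * 2 := by norm_num
        rw [h4]; exact mul_ne_zero (mul_ne_zero h2 h2) hn
      simp [this]
    · rw [zero_add]
      obtain ⟨l, hl, hl0⟩ : ∃ l : F, k = l⁻¹ ∧ l ≠ 0 := ⟨k⁻¹, by simp, inv_ne_zero hk⟩
      subst hl
      rw [inv_inv]
      set D := l ^ 2 + 2 * l + 1 - m with hD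
      have hr : 1 + ((1 - m) * l⁻¹ ^ 2 + 2 * l⁻¹) = D / l ^ 2 := by
        rw [hD]; field_simp; ring
      rw [hr]
      have a1 : ∀ u : F, ((1 * l + 1) ^ 2 - m) * (((1 * l + 1) - 1) * u + (1 - m)) *
        (u ^ 2 - 4 * (1 * l + 1) * u + 4 * m) =
        D * (l * (u - 2 * (l + 1)) + (D + l ^ 2)) * ((u - 2 * (l + 1)) ^ 2 - 4 * D) := by
        intro u; rw [hD]; ring
      simp_rw [a1]
      by_cases hD0 : D = 0
      · simp [hD0]
      have a2 := k3_sum_affine (fun T => χ (D * (l * T + (D + l ^ 2)) * (T ^ 2 - 4 * D)))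
        1 (-(2 * (l + 1))) one_ne_zero
      simp only [one_mul, ← sub_eq_add_neg] at a2
      rw [a2]
      have a3 := k3_sum_inv hF (fun T => χ (l * T + (D + l ^ 2))) D hD0
      simp_rw [mul_add, mul_one, Finset.sum_add_distrib] at a3
      simp_rw [← mul_add] at a3
      rw [k3_chi_lin hF _ _ hl0, zero_add] at a3
      simp_rw [mul_assoc D, map_mul χ D]
      rw [← Finset.mul_sum]
      simp_rw [map_mul]
      rw [← a3]
      rw [← k3_sum_affine (fun x => if x = 0 then 0 else χ (l * (x + D / x) + (D + l ^ 2))) l 0 hl0,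
        Finset.mul_sum]
      refine Finset.sum_congr rfl fun z _ => ?_
      rw [add_zero]
      by_cases hz : z = 0
      · simp [hz]
      · rw [if_neg (mul_ne_zero hl0 hz)]
        simp_rw [← map_mul]
        rw [← k3_sq_mul z (D * _) hz,
          ← k3_sq_mul (l ^ 2) (z * _ * _ * _) (pow_ne_zero 2 hl0)]
        congr 1
        field_simp
        ring
  simp_rw [e1]
  rw [Finset.sum_add_distrib]
  simp

lemma k3_S5 (hF : ringChar F ≠ 2) (m : F) (hm1 : m ≠ 1) :
    ∑ k : F, ∑ z : F,
      χ (z * (z + 1) * (1 + ((1 - m) * k ^ 2 + 2 * k)) *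
        (z + (1 + ((1 - m) * k ^ 2 + 2 * k)))) =
    1 + ∑ s : F, ∑ z : F, χ (z * (z + 1) * s * (z + s) * (m + (1 - m) * s)) := by
  have h2 := k3_two hF
  have hn : 1 - m ≠ 0 := sub_ne_zero.2 (Ne.symm hm1)
  rw [k3_sum_quad hF (fun r => ∑ z : F, χ (z * (z + 1) * (1 + r) * (z + (1 + r)))) (1 - m) 2 hn]
  rw [← k3_sum_affine (fun r => (∑ z : F, χ (z * (z + 1) * (1 + r) * (z + (1 + r)))) *
    (1 + χ (2 ^ 2 + 4 * (1 - m) * r))) 1 (-1) one_ne_zero]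
  have e0 : ∀ s : F, 1 + (1 * s + -1) = s := fun s => by ring
  have e1 : ∀ s : F, χ (2 ^ 2 + 4 * (1 - m) * (1 * s + -1)) = χ (m + (1 - m) * s) := by
    intro s
    rw [← k3_sq_mul 2 (m + (1 - m) * s) h2]
    congr 1
    ring
  simp_rw [e0, e1, mul_add, mul_one, Finset.sum_add_distrib, Finset.sum_mul, ← map_mul]
  congr 1
  · rw [Finset.sum_comm]
    have : ∀ z : F, ∑ s : F, χ ((z * z + z) * s * z + (z * z + z) * s * s) = - χ (z * (z + 1)) := by
      intro z
      by_cases hz : z = 0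
      · simp [hz]
      · have e : ∀ s, (z * z + z) * s * z + (z * z + z) * s * s = z * (z + 1) * (s * (s + z)) := by
          intro s; ring
        simp_rw [e, map_mul χ (z * (z + 1))]
        rw [← Finset.mul_sum, k3_chi_prod hF z hz]
        ring
    simp_rw [this]
    rw [Finset.sum_neg_distrib, k3_chi_prod hF 1 one_ne_zero]
    ring
  · refine Finset.sum_congr rfl fun s _ => Finset.sum_congr rfl fun z _ => ?_
    congr 1
    ring

/-- The main character sum identity. -/
lemma k3_main (hF : ringChar F ≠ 2) (l : F) (h0 : l ≠ 0) (h1 : l + 1 ≠ 0) :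
    (∑ x : F, χ (x ^ 3 - 2 * x ^ 2 + l / (l + 1) * x)) ^ 2 = Fintype.card F +
      ∑ x : F, ∑ y : F, χ ((l + 1) * x * y * (l + x) * (x + y) * (1 + y)) := by
  have hm : l / (l + 1) ≠ 0 := div_ne_zero h0 h1
  have hm1 : l / (l + 1) ≠ 1 := by
    intro h
    rw [div_eq_one_iff_eq h1] at h
    simp at h
  rw [k3_S1 hF _ hm, mul_pow, k3_S2 hF _ hm hm1, k3_S3 hF _ hm, k3_S4 hF _ hm1, k3_S5 hF _ hm1]
  rw [← map_pow, k3_sq _ (k3_two hF)]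
  have : ∀ s z : F, χ (z * (z + 1) * s * (z + s) * (l / (l + 1) + (1 - l / (l + 1)) * s)) =
      χ ((l + 1) * s * z * (l + s) * (s + z) * (1 + z)) := by
    intro s z
    rw [← k3_sq_mul (l + 1) _ h1]
    congr 1
    field_simp
    ring
  simp_rw [this]
  ring

lemma k3_card_E (hF : ringChar F ≠ 2) (f : F → F) :
    (Nat.card {xy : F × F // xy.2 ^ 2 = f xy.1} : ℤ) = Fintype.card F + ∑ x : F, χ (f x) := by
  rw [Nat.card_eq_fintype_card, Fintype.card_subtype, Finset.card_filter]
  push_cast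
  rw [Fintype.sum_prod_type]
  simp_rw [k3_card_sq hF, Finset.sum_add_distrib]
  simp

lemma k3_proj (hF : ringChar F ≠ 2) (l : F) :
    ∑ a : F, ∑ b : F, ∑ c : F, χ ((l + 1) * a * b * c * (l * a + b) * (b + c) * (a + c)) =
    (Fintype.card F - 1) * ∑ x : F, ∑ y : F, χ ((l + 1) * x * y * (l + x) * (x + y) * (1 + y)) := by
  have e : ∀ a : F, ∑ b : F, ∑ c : F, χ ((l + 1) * a * b * c * (l * a + b) * (b + c) * (a + c)) =
      (1 - if a = 0 then 1 else 0) *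
        ∑ x : F, ∑ y : F, χ ((l + 1) * x * y * (l + x) * (x + y) * (1 + y)) := by
    intro a
    split_ifs with ha
    · subst ha; simp
    · rw [← k3_sum_affine (fun b => ∑ c : F,
        χ ((l + 1) * a * b * c * (l * a + b) * (b + c) * (a + c))) a 0 ha, sub_zero, one_mul]
      refine Finset.sum_congr rfl fun x _ => ?_
      rw [← k3_sum_affine (fun c =>
        χ ((l + 1) * a * (a * x + 0) * c * (l * a + (a * x + 0)) * ((a * x + 0) + c) * (a + c)))
        a 0 ha]
      refine Finset.sum_congr rfl fun y _ => ?_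
      rw [← k3_sq_mul (a ^ 3) ((l + 1) * x * y * (l + x) * (x + y) * (1 + y)) (pow_ne_zero 3 ha)]
      congr 1
      ring
  simp_rw [e]
  rw [← Finset.sum_mul, Finset.sum_sub_distrib]
  simp

lemma k3_card_K (hF : ringChar F ≠ 2) (f : F → F → F → F) (hf : f 0 0 0 = 0) :
    (Nat.card {v : F × F × F × F // (v.2.1, v.2.2.1, v.2.2.2) ≠ (0, 0, 0) ∧
      v.1 ^ 2 = f v.2.1 v.2.2.1 v.2.2.2} : ℤ) =
    (Fintype.card F : ℤ) ^ 3 - 1 + ∑ a : F, ∑ b : F, ∑ c : F, χ (f a b c) := by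
  rw [Nat.card_eq_fintype_card, Fintype.card_subtype, Finset.card_filter]
  push_cast
  rw [Fintype.sum_prod_type, Finset.sum_comm]
  have e : ∀ w : F × F × F, (∑ x : F, if (w.1, w.2.1, w.2.2) ≠ (0, 0, 0) ∧
      x ^ 2 = f w.1 w.2.1 w.2.2 then (1 : ℤ) else 0) =
      1 + χ (f w.1 w.2.1 w.2.2) - if w = 0 then 1 else 0 := by
    rintro ⟨a, b, c⟩
    by_cases h : (a, b, c) = (0, 0, 0)
    · have h' := h
      simp only [Prod.mk.injEq] at h'
      obtain ⟨rfl, rfl, rfl⟩ := h'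
      simp [hf]
    · have h' : ¬ ((a, b, c) : F × F × F) = 0 := h
      simp only [h, h', ne_eq, not_false_eq_true, true_and, if_false, sub_zero]
      exact k3_card_sq hF _
  simp_rw [e]
  rw [Finset.sum_sub_distrib, Finset.sum_add_distrib]
  simp only [Fintype.sum_prod_type (f := fun w : F × F × F => χ (f w.1 w.2.1 w.2.2)),
    Fintype.sum_prod_type (f := fun w : F × F => χ (f _ w.1 w.2))]
  simp [Fintype.card_prod]
  ring

end K3aux


/-- Theorem 3.10 of the paper.
Let `p` be an odd prime and `λ ∈ F_p` with `λ ≠ 0, -1`, and let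
`a = p − #{(x,y) : y² = x³ − 2x² + (λ/(λ+1))x}` be the trace of Frobenius of `E_λ`.
Then the number of `(v,z₀,z₁,z₂) ∈ F_p⁴` with `(z₀,z₁,z₂) ≠ (0,0,0)` and
`v² = (λ+1)·z₀·z₁·z₂·(λz₀+z₁)·(z₁+z₂)·(z₀+z₂)` equals `(p−1)·(p² + 1 + a²)`. -/
theorem statement2 (p : ℕ) [Fact p.Prime] (hodd : Odd p)
    (lam : ZMod p) (h0 : lam ≠ 0) (h1 : lam ≠ -1)
    (a : ℤ)
    (ha : a = p - Nat.card {xy : ZMod p × ZMod p //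
      xy.2 ^ 2 = xy.1 ^ 3 - 2 * xy.1 ^ 2 + (lam / (lam + 1)) * xy.1}) :
    (Nat.card {v : ZMod p × ZMod p × ZMod p × ZMod p //
        (v.2.1, v.2.2.1, v.2.2.2) ≠ (0, 0, 0) ∧
        v.1 ^ 2 = (lam + 1) * v.2.1 * v.2.2.1 * v.2.2.2 * (lam * v.2.1 + v.2.2.1) *
          (v.2.2.1 + v.2.2.2) * (v.2.1 + v.2.2.2)} : ℤ) =
      (p - 1) * (p ^ 2 + 1 + a ^ 2) := by
  have hF : ringChar (ZMod p) ≠ 2 := by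
    rw [ZMod.ringChar_zmod_n]
    rintro rfl
    exact absurd hodd (by decide)
  have h1' : lam + 1 ≠ 0 := fun h => h1 (eq_neg_of_add_eq_zero_left h)
  have hE := k3_card_E hF (fun x : ZMod p => x ^ 3 - 2 * x ^ 2 + (lam / (lam + 1)) * x)
  have hK := k3_card_K hF (fun a b c : ZMod p =>
    (lam + 1) * a * b * c * (lam * a + b) * (b + c) * (a + c)) (by simp)
  have hm := k3_main hF lam h0 h1'
  rw [hE] at ha
  rw [hK, k3_proj hF lam]
  rw [ZMod.card] at hm ha ⊢
  rw [ha]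
  linear_combination (1 - (p : ℤ)) * hm
end

section
/- Let p be an odd prime, let φ : F_p → ℤ be the quadratic character, and let λ ∈ F_p with λ ≠ 0 and λ ≠ -1. Then #{(w,y_0,y_1,y_2) ∈ F_p^4 : (y_0,y_1,y_2) ≠ (0,0,0) and w^2 = λ·(λ+1)·y_0·y_1·y_2·(y_0+y_1)·(λ·y_0+y_2)·(y_1+y_2)} = (p−1)·(p^2 + p + 1 + φ(λ)·(a_{λ,p}^2 − p)). -/
section Helpers

variable {F : Type*} [Field F] [Fintype F] [DecidableEq F]

local notation "χ" => quadraticChar F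

theorem chi_sq_mul (c z : F) (hc : c ≠ 0) : χ (c ^ 2 * z) = χ z := by
  rw [map_mul, quadraticChar_sq_one' hc, one_mul]

theorem chi_mul_self (c : F) (hc : c ≠ 0) : χ c * χ c = 1 := by
  rw [← pow_two, quadraticChar_sq_one hc]

theorem sum_affine (g : F → ℤ) (a b : F) (ha : a ≠ 0) : ∑ x, g (a * x + b) = ∑ x, g x := by
  refine Fintype.sum_bijective (fun x => a * x + b) ?_ _ _ (fun x => rfl)
  refine ⟨fun x y h => ?_, fun y => ⟨(y - b) / a, ?_⟩⟩
  · have : a * x = a * y := by simpa using h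
    exact mul_left_cancel₀ ha this
  · field_simp; ring

theorem sum_except (A B : F → ℤ) (e : F) (h : ∀ x, x ≠ e → A x = B x) :
    ∑ x, A x = ∑ x, B x + (A e - B e) := by
  rw [← Finset.add_sum_erase _ A (Finset.mem_univ e), ← Finset.add_sum_erase _ B (Finset.mem_univ e),
    Finset.sum_congr rfl (fun x hx => h x (Finset.ne_of_mem_erase hx))]
  ring

theorem sum_chi_affine (h2 : ringChar F ≠ 2) (a b : F) (ha : a ≠ 0) :
    ∑ x, χ (a * x + b) = 0 := by
  rw [sum_affine (fun x => χ x) a b ha, quadraticChar_sum_zero h2]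

theorem sum_sq (h2 : ringChar F ≠ 2) (g : F → ℤ) :
    ∑ t, g (t ^ 2) = ∑ q, g q * (1 + χ q) := by
  rw [← Finset.sum_fiberwise Finset.univ (fun t : F => t ^ 2)]
  refine Finset.sum_congr rfl fun q _ => ?_
  rw [Finset.sum_congr rfl (g := fun _ => g q)]
  · rw [Finset.sum_const, nsmul_eq_mul, add_comm, ← quadraticChar_card_sqrts h2 q, mul_comm]
    congr 3
    ext x; simp
  · intro x hx
    simp at hx
    rw [hx]

theorem sum_inv (g : F → ℤ) : ∑ x, g x⁻¹ = ∑ x, g x :=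
  Fintype.sum_bijective (fun x => x⁻¹) inv_involutive.bijective _ _ (fun x => rfl)

theorem sum_sq_sub (h2 : ringChar F ≠ 2) (D : F) (hD : D ≠ 0) :
    ∑ t, χ (t ^ 2 - D) = -1 := by
  rw [sum_sq h2 (fun x => χ (x - D))]
  simp only [mul_add, mul_one, Finset.sum_add_distrib]
  have h1 : ∑ x, χ (x - D) = 0 := by
    have := sum_chi_affine h2 (1 : F) (-D) one_ne_zero
    simpa [sub_eq_add_neg] using this
  rw [h1, ← sum_inv]
  rw [sum_except (fun x => χ (x⁻¹ - D) * χ x⁻¹) (fun x => χ (-D * x + 1)) 0]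
  · rw [sum_chi_affine h2 _ _ (neg_ne_zero.mpr hD)]
    simp
  · intro x hx
    rw [← map_mul, ← chi_sq_mul x _ hx]
    congr 1
    field_simp
    ring

theorem sum_quad (h2 : ringChar F ≠ 2) (a b c : F) (ha : a ≠ 0) (hD : b ^ 2 - 4 * a * c ≠ 0) :
    ∑ x, χ (a * x ^ 2 + b * x + c) = - χ a := by
  have two : (2 : F) ≠ 0 := Ring.two_ne_zero h2
  have h := sum_affine (fun t => χ a * χ (t ^ 2 - (b ^ 2 - 4 * a * c))) (2 * a) b
    (mul_ne_zero two ha)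
  rw [← Finset.mul_sum Finset.univ (fun t => χ (t ^ 2 - (b ^ 2 - 4 * a * c))),
    sum_sq_sub h2 _ hD] at h
  rw [show -χ a = χ a * -1 by ring, ← h]
  refine Finset.sum_congr rfl fun x _ => ?_
  rw [← map_mul, ← chi_sq_mul (2 * a) _ (mul_ne_zero two ha)]
  congr 1
  ring

theorem sum_symm (h2 : ringChar F ≠ 2) (g : F → F → ℤ) :
    ∑ x, ∑ y, g (x + y) (x * y) = ∑ s, ∑ q, g s q * (1 + χ (s ^ 2 - 4 * q)) := by
  have two : (2 : F) ≠ 0 := Ring.two_ne_zero h2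
  have four : (4 : F) ≠ 0 := by
    rw [show (4 : F) = 2 * 2 by norm_num]; exact mul_ne_zero two two
  have e1 : ∀ x : F, ∑ y, g (x + y) (x * y) = ∑ s, g s (x * (s - x)) := by
    intro x
    rw [← sum_affine (fun s => g s (x * (s - x))) 1 x one_ne_zero]
    refine Finset.sum_congr rfl fun y _ => ?_
    congr 1 <;> ring
  simp only [e1]
  rw [Finset.sum_comm]
  refine Finset.sum_congr rfl fun s _ => ?_
  rw [← sum_affine (fun x => g s (x * (s - x))) (1 / 2) (s / 2) (one_div_ne_zero two)]
  have e2 := sum_sq h2 (fun D => g s ((s ^ 2 - D) / 4))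
  rw [← sum_affine (fun D => g s ((s ^ 2 - D) / 4) * (1 + χ D)) (-4) (s ^ 2)
    (neg_ne_zero.mpr four)] at e2
  convert e2 using 3
  · field_simp; ring
  · congr 1; field_simp; ring
  · congr 2; ring

/-- The fibre sum. -/
def SX (q : F) : ℤ := ∑ X : F, χ (X * ((X - 1 - q) ^ 2 - 4 * q))

theorem SX_eq (q : F) : ∑ s : F, χ ((1 + s + q) * (s ^ 2 - 4 * q)) = SX q := by
  unfold SX
  rw [← sum_affine (fun X => χ (X * ((X - 1 - q) ^ 2 - 4 * q))) 1 (1 + q) one_ne_zero]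
  refine Finset.sum_congr rfl fun s _ => ?_
  congr 1; ring

/-- common part: symmetric sums twisted by a function of the product. -/
theorem sum_ut (h2 : ringChar F ≠ 2) (h : F → F) :
    ∑ u, ∑ t, χ (h (u * t) * (1 + u) * (1 + t)) = ∑ q, χ (h q) * SX q := by
  have e := sum_symm h2 (fun s q => χ (h q * (1 + s + q)))
  have e0 : ∑ u : F, ∑ t : F, χ (h (u * t) * (1 + u) * (1 + t)) =
      ∑ u, ∑ t, χ (h (u * t) * (1 + (u + t) + u * t)) := by
    refine Finset.sum_congr rfl fun s _ => Finset.sum_congr rfl fun q _ => ?_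
    congr 1; ring
  rw [e0, e, Finset.sum_comm]
  refine Finset.sum_congr rfl fun q _ => ?_
  simp only [mul_add, mul_one, Finset.sum_add_distrib]
  have z : ∑ s, χ (h q * 1 + h q * s + h q * q) = 0 := by
    have := sum_chi_affine h2 (1 : F) (1 + q) one_ne_zero
    rw [← mul_zero (χ (h q)), ← this, Finset.mul_sum]
    refine Finset.sum_congr rfl fun s _ => ?_
    rw [← map_mul]; congr 1; ring
  rw [mul_one] at z
  rw [z, zero_add, ← SX_eq, Finset.mul_sum]
  refine Finset.sum_congr rfl fun s _ => ?_
  rw [← map_mul, ← map_mul]; congr 1; ring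

theorem sum_U (h2 : ringChar F ≠ 2) : ∑ q : F, χ q * SX q = 1 := by
  have := sum_ut h2 (fun q : F => q)
  rw [← this]
  have h := sum_quad h2 (1 : F) 1 0 one_ne_zero (by simp)
  have : ∑ u : F, ∑ t : F, χ (u * t * (1 + u) * (1 + t)) =
     (∑ u : F, χ (1 * u ^ 2 + 1 * u + 0)) * (∑ u : F, χ (1 * u ^ 2 + 1 * u + 0)) := by
    rw [Finset.sum_mul_sum]
    refine Finset.sum_congr rfl fun s _ => Finset.sum_congr rfl fun q _ => ?_
    rw [← map_mul]; congr 1; ring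
  rw [this, h]; simp

theorem SX_inv (q : F) (hq : q ≠ 0) : SX q⁻¹ = χ q * SX q := by
  unfold SX
  rw [← sum_affine _ q⁻¹ 0 (inv_ne_zero hq), Finset.mul_sum]
  refine Finset.sum_congr rfl fun s _ => ?_
  rw [← map_mul, ← chi_sq_mul (q ^ 2) _ (pow_ne_zero 2 hq)]
  congr 1
  field_simp
  ring

theorem R_eq (h2 : ringChar F ≠ 2) (l : F) :
    ∑ u, ∑ v, χ ((l + 1) * u * v * (1 + u) * (l + v) * (u + v)) =
      ∑ q, χ ((l + 1) * (1 + l * q)) * (χ q * SX q) := by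
  have e1 : ∑ u, ∑ v, χ ((l + 1) * u * v * (1 + u) * (l + v) * (u + v)) =
      ∑ u, ∑ t, χ ((l + 1) * (u * t) * (l + u * t) * (1 + u) * (1 + t)) := by
    refine Finset.sum_congr rfl fun u _ => ?_
    by_cases hu : u = 0
    · subst hu; simp
    · rw [← sum_affine _ u 0 hu]
      refine Finset.sum_congr rfl fun t _ => ?_
      rw [← chi_sq_mul u ((l + 1) * (u * t) * (l + u * t) * (1 + u) * (1 + t)) hu]
      congr 1; ring
  rw [e1, sum_ut h2 (fun q => (l + 1) * q * (l + q)), ← sum_inv]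
  refine Finset.sum_congr rfl fun q _ => ?_
  by_cases hq : q = 0
  · subst hq; simp
  · rw [SX_inv q hq]
    congr 1
    rw [← chi_sq_mul q _ hq]
    congr 1
    field_simp
    ring

theorem P_eq (h2 : ringChar F ≠ 2) (d : F) (hd : d ≠ 0) (he : 1 - d ≠ 0) :
    ∑ s, ∑ q, χ ((1 + s + q) * ((q + d) ^ 2 - d * s ^ 2)) = Fintype.card F := by
  have four : (4 : F) ≠ 0 := by
    rw [show (4 : F) = 2 * 2 by norm_num]
    exact mul_ne_zero (Ring.two_ne_zero h2) (Ring.two_ne_zero h2)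
  rw [Finset.sum_comm]
  have e1 : ∀ q : F, ∑ s, χ ((1 + s + q) * ((q + d) ^ 2 - d * s ^ 2)) =
      ∑ X, χ (X * ((q + d) ^ 2 - d * (X - 1 - q) ^ 2)) := by
    intro q
    rw [← sum_affine (fun X => χ (X * ((q + d) ^ 2 - d * (X - 1 - q) ^ 2))) 1 (1 + q) one_ne_zero]
    refine Finset.sum_congr rfl fun s _ => ?_
    congr 1; ring
  simp only [e1]
  rw [Finset.sum_comm]
  have e2 : ∀ X : F, ∑ q, χ (X * ((q + d) ^ 2 - d * (X - 1 - q) ^ 2)) =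
      χ X * ∑ Q, χ ((1 - d) * Q ^ 2 + 2 * d * (X - (1 - d)) * Q + - d * (X - (1 - d)) ^ 2) := by
    intro X
    rw [← sum_affine (fun Q => χ ((1 - d) * Q ^ 2 + 2 * d * (X - (1 - d)) * Q
      + - d * (X - (1 - d)) ^ 2)) 1 d one_ne_zero, Finset.mul_sum]
    refine Finset.sum_congr rfl fun s _ => ?_
    rw [← map_mul]
    congr 1; ring
  simp only [e2]
  rw [sum_except _ (fun X => χ X * (- χ (1 - d))) (1 - d)]
  · rw [← Finset.sum_mul, quadraticChar_sum_zero h2]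
    have : ∑ Q : F, χ ((1 - d) * Q ^ 2) = χ (1 - d) * (Fintype.card F - 1) := by
      rw [sum_except _ (fun _ => χ (1 - d)) 0]
      · simp; ring
      · intro x hx
        rw [mul_comm, chi_sq_mul _ _ hx]
    simp only [sub_self, mul_zero, zero_mul, add_zero, ne_eq, OfNat.ofNat_ne_zero, not_false_eq_true,
      zero_pow, zero_add, this]
    linear_combination (Fintype.card F : ℤ) * chi_mul_self (1 - d) he
  · intro X hX
    rw [sum_quad h2 _ _ _ he]
    have : X - (1 - d) ≠ 0 := sub_ne_zero.mpr hX
    have h4 : 4 * d * (X - (1 - d)) ^ 2 ≠ 0 := mul_ne_zero (mul_ne_zero four hd) (pow_ne_zero 2 this)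
    intro h; apply h4; rw [← h]; ring

theorem inner_eq (h2 : ringChar F ≠ 2) (d n : F) :
    ∑ X, χ (X * ((1 - n) ^ 2 * (X - (1 - d)) ^ 2 - 4 * n * (X - (1 - d)) + 4 * d)) =
      SX (n ^ 2 - d * (1 - n) ^ 2) := by
  have two : (2 : F) ≠ 0 := Ring.two_ne_zero h2
  have four : (4 : F) ≠ 0 := by
    rw [show (4 : F) = 2 * 2 by norm_num]; exact mul_ne_zero two two
  unfold SX
  by_cases hn : n = 1
  · subst hn
    have hA : ∑ X : F, χ (X * ((1 - 1) ^ 2 * (X - (1 - d)) ^ 2 - 4 * 1 * (X - (1 - d)) + 4 * d)) =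
        - χ (-1) := by
      rw [← sum_quad h2 (-1 : F) 1 0 (neg_ne_zero.mpr one_ne_zero) (by simp)]
      refine Finset.sum_congr rfl fun X _ => ?_
      rw [← chi_sq_mul 2 (-1 * X ^ 2 + 1 * X + 0) two]
      congr 1; ring
    rw [hA, sum_except _ (fun X => χ (1 * X + (-4))) 0]
    · rw [sum_chi_affine h2 _ _ one_ne_zero]
      simp only [zero_mul, mul_zero, zero_add, MulChar.map_zero, zero_sub]
      rw [← chi_sq_mul 2 (-1) two]
      congr 2; ring
    · intro X hX
      rw [← chi_sq_mul X (1 * X + -4) hX]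
      congr 1; ring
  · have hn' : 1 - n ≠ 0 := sub_ne_zero.mpr (Ne.symm hn)
    rw [← sum_affine (fun X => χ (X * ((X - 1 - (n ^ 2 - d * (1 - n) ^ 2)) ^ 2 - 4 * (n ^ 2 - d * (1 - n) ^ 2)))) ((1 - n) ^ 2) 0 (pow_ne_zero 2 hn')]
    refine Finset.sum_congr rfl fun X _ => ?_
    rw [← chi_sq_mul ((1 - n) ^ 2) _ (pow_ne_zero 2 hn')]
    congr 1; ring

theorem T_eq (h2 : ringChar F ≠ 2) (d : F) (hd : d ≠ 0) (he : 1 - d ≠ 0) :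
    ∑ s, ∑ q, χ ((1 + s + q) * ((q + d) ^ 2 - d * s ^ 2) * (s ^ 2 - 4 * q)) =
      ∑ n, χ (n ^ 2 - d * (1 - n) ^ 2) * SX (n ^ 2 - d * (1 - n) ^ 2) - 1 := by
  have two : (2 : F) ≠ 0 := Ring.two_ne_zero h2
  have four : (4 : F) ≠ 0 := by
    rw [show (4 : F) = 2 * 2 by norm_num]; exact mul_ne_zero two two
  have eR : ∑ n, χ (n ^ 2 - d * (1 - n) ^ 2) * SX (n ^ 2 - d * (1 - n) ^ 2) =
      ∑ X, ∑ n, χ ((n ^ 2 - d * (1 - n) ^ 2) *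
        (X * ((1 - n) ^ 2 * (X - (1 - d)) ^ 2 - 4 * n * (X - (1 - d)) + 4 * d))) := by
    rw [Finset.sum_comm]
    refine Finset.sum_congr rfl fun n _ => ?_
    rw [← inner_eq h2, Finset.mul_sum]
    simp only [← map_mul]
  have e1 : ∀ q : F, ∑ s, χ ((1 + s + q) * ((q + d) ^ 2 - d * s ^ 2) * (s ^ 2 - 4 * q)) =
      ∑ X, χ (X * ((q + d) ^ 2 - d * (X - 1 - q) ^ 2) * ((X - 1 - q) ^ 2 - 4 * q)) := by
    intro q
    rw [← sum_affine (fun X => χ (X * ((q + d) ^ 2 - d * (X - 1 - q) ^ 2) * ((X - 1 - q) ^ 2 - 4 * q))) 1 (1 + q) one_ne_zero]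
    refine Finset.sum_congr rfl fun s _ => ?_
    congr 1; ring
  rw [Finset.sum_comm, eR]
  simp only [e1]
  rw [Finset.sum_comm, sum_except _ (fun X => ∑ n, χ ((n ^ 2 - d * (1 - n) ^ 2) *
        (X * ((1 - n) ^ 2 * (X - (1 - d)) ^ 2 - 4 * n * (X - (1 - d)) + 4 * d)))) (1 - d)]
  · have hA : ∑ q, χ ((1 - d) * ((q + d) ^ 2 - d * (1 - d - 1 - q) ^ 2) * ((1 - d - 1 - q) ^ 2 - 4 * q)) = -1 - χ d := by
      have hq := sum_quad h2 (1 : F) (-4) (4 * d) one_ne_zero (by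
        have : 4 * 4 * (1 - d) ≠ 0 := mul_ne_zero (mul_ne_zero four four) he
        intro h; apply this; rw [← h]; ring)
      rw [← sum_affine _ 1 (-d) one_ne_zero,
        sum_except _ (fun x => χ (1 * x ^ 2 + (-4) * x + 4 * d)) 0, hq]
      · have : χ (4 * d) = χ d := by
          rw [← chi_sq_mul 2 d two]; congr 1; ring
        simp [this]
        ring
      · intro x hx
        rw [← chi_sq_mul (x * (1 - d)) (1 * x ^ 2 + (-4) * x + 4 * d) (mul_ne_zero hx he)]
        congr 1; ring
    have hB : ∑ n, χ ((n ^ 2 - d * (1 - n) ^ 2) *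
        ((1 - d) * ((1 - n) ^ 2 * ((1 - d) - (1 - d)) ^ 2 - 4 * n * ((1 - d) - (1 - d)) + 4 * d))) = - χ d := by
      have hq := sum_quad h2 (1 - d) (2 * d) (-d) he (by
        have : 4 * d ≠ 0 := mul_ne_zero four hd
        intro h; apply this; rw [← h]; ring)
      have : - χ d = χ (d * (1 - d)) * (- χ (1 - d)) := by
        rw [map_mul]
        linear_combination χ d * chi_mul_self (1 - d) he
      rw [this, ← hq, Finset.mul_sum]
      refine Finset.sum_congr rfl fun n _ => ?_
      rw [← map_mul, ← chi_sq_mul 2 (d * (1 - d) * _) two]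
      congr 1; ring
    rw [hA, hB]; ring
  · intro X hX
    have hc : X - (1 - d) ≠ 0 := sub_ne_zero.mpr hX
    rw [← sum_affine _ (X - (1 - d)) (-d) hc]
    refine Finset.sum_congr rfl fun n _ => ?_
    rw [← chi_sq_mul (X - (1 - d)) ((n ^ 2 - d * (1 - n) ^ 2) * _) hc]
    congr 1; ring

theorem sum_n (h2 : ringChar F ≠ 2) (d : F) (he : 1 - d ≠ 0) (G : F → ℤ) :
    ∑ n, G (n ^ 2 - d * (1 - n) ^ 2) = ∑ q, G q * (1 + χ ((1 - d) * q + d)) := by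
  have h := sum_sq h2 (fun r => G ((r - d) / (1 - d)))
  rw [← sum_affine _ (1 - d) d he, ← sum_affine (fun r => _ * (1 + χ r)) (1 - d) d he] at h
  convert h using 3
  · field_simp; ring
  · congr 1; field_simp; ring

theorem main_sum (h2 : ringChar F ≠ 2) (l : F) (h0 : l ≠ 0) (h1 : l + 1 ≠ 0) :
    (∑ x, χ (x ^ 3 - 2 * x ^ 2 + (l / (l + 1)) * x)) ^ 2 = Fintype.card F +
      ∑ u, ∑ v, χ ((l + 1) * u * v * (1 + u) * (l + v) * (u + v)) := by
  obtain ⟨d, hdd⟩ : ∃ d, d = 1 / (l + 1) := ⟨_, rfl⟩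
  have hd : d ≠ 0 := by rw [hdd]; exact one_div_ne_zero h1
  have hel : 1 - d = l / (l + 1) := by rw [hdd]; field_simp; ring
  have he : 1 - d ≠ 0 := by rw [hel]; exact div_ne_zero h0 h1
  have ea : ∑ x, χ (x ^ 3 - 2 * x ^ 2 + (l / (l + 1)) * x) = ∑ x, χ ((1 + x) * (x ^ 2 - d)) := by
    rw [← sum_affine _ 1 1 one_ne_zero]
    refine Finset.sum_congr rfl fun n _ => ?_
    rw [← hel]; congr 1; ring
  have e2 : (∑ x, χ ((1 + x) * (x ^ 2 - d))) ^ 2 =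
      ∑ x, ∑ y, χ ((1 + (x + y) + x * y) * ((x * y + d) ^ 2 - d * (x + y) ^ 2)) := by
    rw [pow_two, Finset.sum_mul_sum]
    refine Finset.sum_congr rfl fun s _ => Finset.sum_congr rfl fun q _ => ?_
    rw [← map_mul]; congr 1; ring
  rw [ea, e2, sum_symm h2 (fun s q => χ ((1 + s + q) * ((q + d) ^ 2 - d * s ^ 2)))]
  rw [R_eq h2]
  obtain ⟨H, hH⟩ : ∃ H : F → F, H = fun q => (l + 1) * (1 + l * q) := ⟨_, rfl⟩
  have hR : ∑ q, χ ((l + 1) * (1 + l * q)) * (χ q * SX q) = ∑ q, χ (H q) * (χ q * SX q) := by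
    rw [hH]
  rw [hR]
  simp only [mul_one_add (α := ℤ), Finset.sum_add_distrib]
  rw [P_eq h2 d hd he]
  simp only [← map_mul χ (_ * _) (_ - _)]
  rw [T_eq h2 d hd he, sum_n h2 d he (fun q => χ q * SX q)]
  simp only [mul_one_add (α := ℤ), Finset.sum_add_distrib]
  rw [sum_U h2]
  have : ∀ q, χ ((1 - d) * q + d) = χ (H q) := by
    intro q
    rw [hH]
    rw [← chi_sq_mul (l + 1) _ h1]
    congr 1
    rw [hel, hdd]; field_simp; ring
  simp only [this]
  rw [add_sub_cancel_left]
  congr 1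
  exact Finset.sum_congr rfl fun n _ => mul_comm _ _

theorem sum_three (l : F) :
    ∑ y0 : F, ∑ y1 : F, ∑ y2 : F, χ (l * (l + 1) * y0 * y1 * y2 * (y0 + y1) * (l * y0 + y2) * (y1 + y2))
     = (Fintype.card F - 1) * (χ l * ∑ u, ∑ v, χ ((l + 1) * u * v * (1 + u) * (l + v) * (u + v))) := by
  rw [sum_except _ (fun _ => (χ l * ∑ u, ∑ v, χ ((l + 1) * u * v * (1 + u) * (l + v) * (u + v)))) 0]
  · simp
    ring
  · intro y hy
    rw [Finset.mul_sum, ← sum_affine _ y 0 hy]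
    refine Finset.sum_congr rfl fun u _ => ?_
    rw [Finset.mul_sum, ← sum_affine _ y 0 hy]
    refine Finset.sum_congr rfl fun v _ => ?_
    rw [← map_mul, ← chi_sq_mul (y ^ 3) (l * _) (pow_ne_zero 3 hy)]
    congr 1; ring

theorem card_sq {ι : Type*} [Fintype ι] (h2 : ringChar F ≠ 2) (f : ι → F) (P : ι → Prop) [DecidablePred P] :
    (Nat.card {w : F × ι // P w.2 ∧ w.1 ^ 2 = f w.2} : ℤ) =
      ∑ i, if P i then χ (f i) + 1 else 0 := by
  classical
  rw [Nat.card_eq_fintype_card, Fintype.card_subtype, Finset.card_filter]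
  push_cast
  rw [Fintype.sum_prod_type_right]
  refine Finset.sum_congr rfl fun i _ => ?_
  by_cases h : P i
  · simp only [h, true_and, if_true]
    rw [← quadraticChar_card_sqrts h2, Finset.sum_boole]
    congr 2
    ext x; simp
  · simp [h]

end Helpers


/-- Corollary 3.11 of the paper.
Let `p` be an odd prime, `φ` the quadratic character of `F_p`, and `λ ∈ F_p` with
`λ ≠ 0, -1`; let `a = p − #{(x,y) : y² = x³ − 2x² + (λ/(λ+1))x}`.  Then the number of
`(w,y₀,y₁,y₂) ∈ F_p⁴` with `(y₀,y₁,y₂) ≠ (0,0,0)` and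
`w² = λ·(λ+1)·y₀·y₁·y₂·(y₀+y₁)·(λy₀+y₂)·(y₁+y₂)` equals
`(p−1)·(p² + p + 1 + φ(λ)·(a² − p))`. -/
theorem statement3 (p : ℕ) [Fact p.Prime] (hodd : Odd p)
    (lam : ZMod p) (h0 : lam ≠ 0) (h1 : lam ≠ -1)
    (a : ℤ)
    (ha : a = p - Nat.card {xy : ZMod p × ZMod p //
      xy.2 ^ 2 = xy.1 ^ 3 - 2 * xy.1 ^ 2 + (lam / (lam + 1)) * xy.1}) :
    (Nat.card {w : ZMod p × ZMod p × ZMod p × ZMod p //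
        (w.2.1, w.2.2.1, w.2.2.2) ≠ (0, 0, 0) ∧
        w.1 ^ 2 = lam * (lam + 1) * w.2.1 * w.2.2.1 * w.2.2.2 * (w.2.1 + w.2.2.1) *
          (lam * w.2.1 + w.2.2.2) * (w.2.2.1 + w.2.2.2)} : ℤ) =
      (p - 1) * (p ^ 2 + p + 1 + quadraticChar (ZMod p) lam * (a ^ 2 - p)) := by
  have hp2 : ringChar (ZMod p) ≠ 2 := by
    rw [ZMod.ringChar_zmod_n]
    rintro rfl
    exact absurd hodd (by decide)
  have h1' : lam + 1 ≠ 0 := fun h => h1 (eq_neg_of_add_eq_zero_left h)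
  have ha' : a = - ∑ x, quadraticChar (ZMod p) (x ^ 3 - 2 * x ^ 2 + (lam / (lam + 1)) * x) := by
    have hc := card_sq hp2
      (fun x : ZMod p => x ^ 3 - 2 * x ^ 2 + (lam / (lam + 1)) * x) (fun _ => True)
    simp only [if_true, Finset.sum_add_distrib, Finset.sum_const, Finset.card_univ, ZMod.card,
      true_and, nsmul_eq_mul, mul_one] at hc
    have hs : Nat.card {xy : ZMod p × ZMod p //
      xy.2 ^ 2 = xy.1 ^ 3 - 2 * xy.1 ^ 2 + (lam / (lam + 1)) * xy.1} =
      Nat.card {w : ZMod p × ZMod p //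
        w.1 ^ 2 = w.2 ^ 3 - 2 * w.2 ^ 2 + (lam / (lam + 1)) * w.2} :=
      Nat.card_congr ((Equiv.prodComm _ _).subtypeEquiv (fun _ => Iff.rfl))
    rw [ha, hs, hc]; ring
  have hm := main_sum hp2 lam h0 h1'
  have h3 := sum_three lam
  have hc := card_sq hp2 (fun y : ZMod p × ZMod p × ZMod p =>
    lam * (lam + 1) * y.1 * y.2.1 * y.2.2 * (y.1 + y.2.1) *
          (lam * y.1 + y.2.2) * (y.2.1 + y.2.2)) (fun y => (y.1, y.2.1, y.2.2) ≠ (0, 0, 0))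
  rw [hc]
  have hs : ∀ f : ZMod p × ZMod p × ZMod p → ℤ, f 0 = 0 →
      ∑ i, (if (i.1, i.2.1, i.2.2) ≠ ((0 : ZMod p), (0 : ZMod p), (0 : ZMod p)) then f i + 1 else 0)
        = ∑ i, f i + (p ^ 3 - 1) := by
    intro f hf
    have : ∀ i : ZMod p × ZMod p × ZMod p,
        (if (i.1, i.2.1, i.2.2) ≠ ((0 : ZMod p), (0 : ZMod p), (0 : ZMod p)) then f i + 1 else 0)
        = f i + (1 - if i = 0 then 1 else 0) := by
      intro i
      by_cases hi : i = 0
      · subst hi; simp [hf]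
      · have hi' : (i.1, i.2.1, i.2.2) ≠ ((0 : ZMod p), (0 : ZMod p), (0 : ZMod p)) := hi
        rw [if_pos hi', if_neg hi]; ring
    simp only [this, Finset.sum_add_distrib, Finset.sum_sub_distrib]
    simp [ZMod.card]
    ring
  rw [hs _ (by simp)]
  simp only [Fintype.sum_prod_type]
  rw [h3]
  rw [ZMod.card] at *
  rw [ha']
  linear_combination -(p - 1) * quadraticChar (ZMod p) lam * hm
end

section
/- Let p be an odd prime, let φ : F_p → ℤ be the quadratic character, and let λ ∈ F_p with λ ≠ 0 and λ ≠ -1. Then #{(t,y_1,y_2,y_4,y_5) ∈ F_p^5 : t^2 = λ·y_1·y_2·(λ+y_1)·(y_1+y_2)·(y_2+1)·y_4·y_5·(1+y_4)·(y_4+y_5)·(y_5+λ)} = p^4 + φ(λ)·(a_{λ,p}^2 − p)^2. -/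
section helpers
open Finset

variable {F : Type*} [Field F] [Fintype F] [DecidableEq F]

lemma kk_sum_inj (g : F → F) (hg : Function.Injective g) (f : F → ℤ) :
    ∑ x, f (g x) = ∑ x, f x :=
  (Finite.injective_iff_bijective.mp hg).sum_comp f

lemma kk_sum_aff (a b : F) (ha : a ≠ 0) (f : F → ℤ) :
    ∑ x, f (a * x + b) = ∑ x, f x := by
  refine kk_sum_inj (fun x => a * x + b) (fun x y h => ?_) f
  simpa [ha] using h

lemma kk_sum_inv (f : F → ℤ) : ∑ x, f x⁻¹ = ∑ x, f x :=
  kk_sum_inj (fun x => x⁻¹) inv_injective f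

lemma kk_sum_one (x0 : F) (f g : F → ℤ) (h : ∀ x, x ≠ x0 → f x = g x) :
    ∑ x, f x = ∑ x, g x - g x0 + f x0 := by
  rw [← Finset.add_sum_erase univ f (mem_univ x0), ← Finset.add_sum_erase univ g (mem_univ x0),
    Finset.sum_congr rfl (fun x hx => h x (Finset.ne_of_mem_erase hx))]
  ring

lemma kk_chi (t A B : F) (ht : t ≠ 0) (h : A * t ^ 2 = B) :
    quadraticChar F A = quadraticChar F B := by
  rw [← h, map_mul, quadraticChar_sq_one' ht, mul_one]

lemma kk_fib (S : Finset F) (q : F → F) (N f : F → ℤ)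
    (h : ∀ r, (#{x ∈ S | q x = r} : ℤ) = N r) :
    ∑ x ∈ S, f (q x) = ∑ r, f r * N r := by
  rw [← Finset.sum_fiberwise S q]
  refine Finset.sum_congr rfl fun r _ => ?_
  rw [← h r, Finset.sum_congr rfl (g := fun _ => f r)]
  · simp [mul_comm]
  · intro x hx
    rw [(Finset.mem_filter.mp hx).2]

lemma kk_four (hF : ringChar F ≠ 2) : (4 : F) ≠ 0 := by
  have h2 : (2 : F) ≠ 0 := Ring.two_ne_zero hF
  have : (4 : F) = 2 * 2 := by norm_num
  rw [this]; exact mul_ne_zero h2 h2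

lemma kk_roots (hF : ringChar F ≠ 2) (a b c : F) (ha : a ≠ 0) :
    (#{x : F | a * x ^ 2 + b * x + c = 0} : ℤ) = 1 + quadraticChar F (b ^ 2 - 4 * a * c) := by
  have h2 : (2 : F) ≠ 0 := Ring.two_ne_zero hF
  rw [add_comm, ← quadraticChar_card_sqrts hF]
  norm_cast
  refine Finset.card_bij (fun x _ => 2 * a * x + b) ?_ ?_ ?_
  · intro x hx
    simp at hx ⊢
    linear_combination 4 * a * hx
  · intro x _ y _ h
    have : 2 * a * (x - y) = 0 := by linear_combination h
    simpa [h2, ha, sub_eq_zero] using this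
  · intro y hy
    simp at hy
    refine ⟨(y - b) / (2 * a), ?_, ?_⟩
    · simp
      field_simp
      linear_combination hy
    · field_simp
      ring

lemma kk_lin (hF : ringChar F ≠ 2) (a b : F) (ha : a ≠ 0) :
    ∑ x, quadraticChar F (a * x + b) = 0 := by
  rw [kk_sum_aff a b ha (fun x => quadraticChar F x)]
  exact quadraticChar_sum_zero hF

lemma kk_quad (hF : ringChar F ≠ 2) (a b c : F) (ha : a ≠ 0) :
    ∑ x, quadraticChar F (a * x ^ 2 + b * x + c) =
      quadraticChar F a * (-1 + if b ^ 2 - 4 * a * c = 0 then (Fintype.card F : ℤ) else 0) := by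
  have h2 : (2 : F) ≠ 0 := Ring.two_ne_zero hF
  rw [kk_fib univ (fun x => a * x ^ 2 + b * x + c)
    (fun r => 1 + quadraticChar F (b ^ 2 - 4 * a * (c - r))) (fun r => quadraticChar F r)]
  swap
  · intro r
    rw [← kk_roots hF a b (c - r) ha]
    congr 2
    ext x
    simp only [mem_filter, mem_univ, true_and]
    constructor <;> intro h <;> linear_combination h
  simp_rw [mul_add, mul_one, Finset.sum_add_distrib, ← map_mul]
  rw [quadraticChar_sum_zero hF, zero_add, ← kk_sum_inv]
  rw [kk_sum_one 0 _ (fun r => quadraticChar F ((b ^ 2 - 4 * a * c) * r + 4 * a))]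
  · have h4 : quadraticChar F (4 * a) = quadraticChar F a :=
      (kk_chi 2 _ _ h2 (by ring)).symm
    split_ifs with h
    · simp only [h]
      simp [h4]
      ring
    · rw [kk_lin hF _ _ h]
      simp [h4]
  · intro x hx
    apply kk_chi x _ _ hx
    field_simp
    ring

lemma kk_frac (hF : ringChar F ≠ 2) (w c : F) (hw : w ≠ 0) (hc : c ≠ 0) (f : F → ℤ) :
    ∑ s, f (w * s + c / s) = f 0 + ∑ r, f r * (1 + quadraticChar F (r ^ 2 - 4 * w * c)) := by
  rw [← Finset.add_sum_erase univ _ (mem_univ (0 : F))]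
  congr 1
  · simp
  · apply kk_fib
    intro r
    have := kk_roots hF w (-r) c hw
    rw [neg_sq] at this
    rw [← this]
    congr 2
    ext x
    simp only [mem_filter, mem_erase, mem_univ, true_and, and_true]
    constructor
    · rintro ⟨hx, h⟩
      rw [← h]
      field_simp
      ring
    · intro h
      have hx : x ≠ 0 := by
        rintro rfl
        simp [hc] at h
      refine ⟨hx, ?_⟩
      field_simp
      linear_combination h

lemma kk_landen (hF : ringChar F ≠ 2) (a b : F) :
    ∑ x, quadraticChar F (x * (x ^ 2 + a * x + b)) =
      ∑ x, quadraticChar F (x * (x ^ 2 - 2 * a * x + a ^ 2 - 4 * b)) := by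
  by_cases hb : b = 0
  · subst hb
    rw [kk_sum_one 0 _ (fun x => quadraticChar F (1 * x + a)), kk_lin hF _ _ one_ne_zero]
    rw [kk_sum_one a (fun x => quadraticChar F (x * (x ^ 2 - 2 * a * x + a ^ 2 - 4 * 0)))
      (fun x => quadraticChar F (1 * x + 0)), kk_lin hF _ _ one_ne_zero]
    · have : a ^ 2 - 2 * a * a + a ^ 2 = 0 := by ring
      simp [this]
    · intro x hx
      symm
      exact kk_chi (x - a) _ _ (sub_ne_zero.mpr hx) (by ring)
    · intro x hx
      symm
      exact kk_chi x _ _ hx (by ring)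
  · rw [kk_sum_one 0 _ (fun x => quadraticChar F (1 * x + b / x + a)),
      kk_frac hF 1 b one_ne_zero hb (fun y => quadraticChar F (y + a))]
    · simp_rw [mul_add, mul_one, Finset.sum_add_distrib, ← map_mul]
      have := kk_lin hF 1 a one_ne_zero
      simp only [one_mul] at this
      rw [this, ← kk_sum_aff 1 a one_ne_zero
        (fun x => quadraticChar F (x * (x ^ 2 - 2 * a * x + a ^ 2 - 4 * b)))]
      simp only [zero_add, div_zero, mul_zero, zero_mul, MulChar.map_zero, add_zero,
        add_sub_cancel_left]
      refine Finset.sum_congr rfl fun x _ => ?_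
      congr 1
      ring
    · intro x hx
      symm
      refine kk_chi x _ _ hx ?_
      field_simp
      ring

/-- The fibre sum. -/
def kkM (c k : F) : ℤ := ∑ x, quadraticChar F (x * (x + (2 - k) ^ 2) * (x + k ^ 2 - 4 * c))

/-- The Legendre sum. -/
def kkL (n : F) : ℤ := ∑ x, quadraticChar F (x * (x + 1) * (x + n))

/-- The other fibre sum. -/
def kkN (c r : F) : ℤ :=
  ∑ v, quadraticChar F (v * (1 - v) * ((r - 1) ^ 2 - (1 - c) * (1 - v)) * (r ^ 2 - c * v))

lemma kk_M2 (hF : ringChar F ≠ 2) (c : F) : kkM c 2 = - quadraticChar F (1 - c) := by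
  have h2 : (2 : F) ≠ 0 := Ring.two_ne_zero hF
  unfold kkM
  rw [kk_sum_one 0 _ (fun x => quadraticChar F (1 * x + 4 * (1 - c))), kk_lin hF _ _ one_ne_zero]
  · have : quadraticChar F (4 * (1 - c)) = quadraticChar F (1 - c) :=
      (kk_chi 2 _ _ h2 (by ring)).symm
    simp [this]
  · intro x hx
    symm
    exact kk_chi x _ _ hx (by ring)

lemma kk_L1 (hF : ringChar F ≠ 2) : kkL (1 : F) = - quadraticChar F (-1) := by
  unfold kkL
  rw [kk_sum_one (-1) _ (fun x => quadraticChar F (1 * x + 0)), kk_lin hF _ _ one_ne_zero]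
  · simp
  · intro x hx
    symm
    refine kk_chi (x + 1) _ _ ?_ (by ring)
    intro h
    exact hx (by linear_combination h)

lemma kk_N0 (hF : ringChar F ≠ 2) (c : F) (hc : c ≠ 0) (hd : 1 - c ≠ 0) :
    kkN c 0 = - quadraticChar F (c * (1 - c)) - quadraticChar F (-1) := by
  unfold kkN
  rw [kk_sum_one 0 _ (fun v => quadraticChar F
    ((c * (1 - c)) * v ^ 2 + (-c * (1 - 2 * c)) * v + - c ^ 2)), kk_quad hF _ _ _ (mul_ne_zero hc hd)]
  · have : (-c * (1 - 2 * c)) ^ 2 - 4 * (c * (1 - c)) * - c ^ 2 ≠ 0 := by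
      have : (-c * (1 - 2 * c)) ^ 2 - 4 * (c * (1 - c)) * - c ^ 2 = c ^ 2 := by ring
      rw [this]
      exact pow_ne_zero 2 hc
    rw [if_neg this]
    have : quadraticChar F (- c ^ 2) = quadraticChar F (-1) :=
      (kk_chi c _ _ hc (by ring)).symm
    simp [this]
  · intro x hx
    symm
    exact kk_chi x _ _ hx (by ring)

lemma kk_NM (hF : ringChar F ≠ 2) (c r : F) (hc : c ≠ 0) (hd : 1 - c ≠ 0) (hr : r ≠ 0) :
    kkN c r = kkM c (r + c / r) - quadraticChar F (c * (1 - c)) := by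
  by_cases hD : 2 * r - r ^ 2 - c = 0
  · have hk : r + c / r = 2 := by
      field_simp
      linear_combination -hD
    rw [hk, kk_M2 hF]
    unfold kkN
    rw [kk_sum_one 0 _ (fun v => quadraticChar F
      (((1 - c) * c) * v ^ 2 + (-(1 - c) * (r ^ 2 + c)) * v + (1 - c) * r ^ 2)),
      kk_quad hF _ _ _ (mul_ne_zero hd hc)]
    · have h1 : r ^ 2 - c ≠ 0 := by
        intro h
        have h2 : (2 : F) ≠ 0 := Ring.two_ne_zero hF
        have : 2 * (r - c) = 0 := by linear_combination hD + h
        have hrc : r = c := by simpa [h2, sub_eq_zero] using this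
        subst hrc
        have : r * (1 - r) = 0 := by linear_combination -h
        simp [hr, hd] at this
      have : (-(1 - c) * (r ^ 2 + c)) ^ 2 - 4 * ((1 - c) * c) * ((1 - c) * r ^ 2) ≠ 0 := by
        have : (-(1 - c) * (r ^ 2 + c)) ^ 2 - 4 * ((1 - c) * c) * ((1 - c) * r ^ 2)
          = ((1 - c) * (r ^ 2 - c)) ^ 2 := by ring
        rw [this]
        exact pow_ne_zero 2 (mul_ne_zero hd h1)
      rw [if_neg this]
      have : quadraticChar F ((1 - c) * r ^ 2) = quadraticChar F (1 - c) :=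
        (kk_chi r _ _ hr (by ring)).symm
      simp [this]
      ring
    · intro x hx
      symm
      refine kk_chi x _ _ hx ?_
      linear_combination (x * (1 - x) * (r ^ 2 - c * x)) * hD
  · set D := 2 * r - r ^ 2 - c with hDd
    have e1 : kkN c r = ∑ u, quadraticChar F ((u - 1) * ((1 - c) - D * u) * (r ^ 2 * u - c))
        - quadraticChar F (c * (1 - c)) := by
      unfold kkN
      rw [← kk_sum_inv]
      rw [kk_sum_one 0 _ (fun u => quadraticChar F ((u - 1) * ((1 - c) - D * u) * (r ^ 2 * u - c)))]
      · simp only [inv_zero, mul_zero, zero_mul, zero_sub, sub_zero, MulChar.map_zero, add_zero]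
        congr 2
        ring
      · intro x hx
        refine kk_chi (x ^ 2) _ _ (pow_ne_zero 2 hx) ?_
        rw [hDd]
        field_simp
        ring
    rw [e1]
    congr 1
    rw [← kk_sum_aff (1 / D) ((1 - c) / D) (one_div_ne_zero hD)]
    have e2 : kkM c (r + c / r) = ∑ x, quadraticChar F (x * (x ^ 2 - 2 *
       (-((r - 1) ^ 2 + ((r - c) / r) ^ 2)) * x + (-((r - 1) ^ 2 + ((r - c) / r) ^ 2)) ^ 2
        - 4 * ((r - 1) * ((r - c) / r)) ^ 2)) := by
      unfold kkM
      refine Finset.sum_congr rfl fun x _ => ?_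
      congr 1
      field_simp
      ring
    rw [e2, ← kk_landen hF, ← kk_sum_aff (-1) 0 (by simp)]
    refine Finset.sum_congr rfl fun x _ => ?_
    symm
    refine kk_chi (r / D) _ _ (div_ne_zero hr hD) ?_
    field_simp
    rw [hDd]
    ring

lemma kk_sumM (hF : ringChar F ≠ 2) (c : F) (hc : c ≠ 0) (hd : 1 - c ≠ 0) :
    ∑ k, kkM c k * (1 + quadraticChar F (k ^ 2 - 4 * c)) =
      2 * quadraticChar F (-1) + Fintype.card F * quadraticChar F (c * (1 - c)) +
      ∑ n, kkL n * quadraticChar F (n * ((1 - c) * n + c)) := by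
  have h2 : (2 : F) ≠ 0 := Ring.two_ne_zero hF
  have h4 := kk_four hF
  have hsq : quadraticChar F (1 - c) * quadraticChar F (1 - c) = 1 := by
    rw [← sq]; exact quadraticChar_sq_one hd
  rw [← kk_sum_aff (-1) 2 (by simp), ← kk_sum_inv]
  rw [kk_sum_one 0 _ (fun j => kkL (4 * (1 - c) * j ^ 2 + (-4) * j + 1) *
    (1 + quadraticChar F (4 * (1 - c) * j ^ 2 + (-4) * j + 1)))]
  swap
  · intro j hj
    congr 1
    · unfold kkM kkL
      rw [← kk_sum_aff ((j⁻¹) ^ 2) 0 (by simp [hj])]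
      refine Finset.sum_congr rfl fun x _ => ?_
      refine kk_chi (j ^ 3) _ _ (pow_ne_zero _ hj) ?_
      field_simp
      ring
    · congr 1
      refine kk_chi j _ _ hj ?_
      field_simp
      ring
  rw [kk_fib univ (fun j => 4 * (1 - c) * j ^ 2 + (-4) * j + 1)
    (fun n => 1 + quadraticChar F ((1 - c) * n + c))
    (fun n => kkL n * (1 + quadraticChar F n))]
  swap
  · intro n
    have := kk_roots hF (4 * (1 - c)) (-4) (1 - n) (mul_ne_zero h4 hd)
    have h' : quadraticChar F ((-4) ^ 2 - 4 * (4 * (1 - c)) * (1 - n)) =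
        quadraticChar F ((1 - c) * n + c) := (kk_chi 4 _ _ h4 (by ring)).symm
    rw [h'] at this
    rw [← this]
    congr 2
    ext x
    simp only [mem_filter, mem_univ, true_and]
    constructor <;> intro h <;> linear_combination h
  have hz : quadraticChar F (2 ^ 2 - 4 * c) = quadraticChar F (1 - c) :=
    (kk_chi 2 _ _ h2 (by ring)).symm
  have s0 : ∑ n : F, kkL n = 0 := by
    unfold kkL
    rw [Finset.sum_comm]
    refine Finset.sum_eq_zero fun x _ => ?_
    simp_rw [map_mul (quadraticChar F) (x * (x + 1))]
    rw [← Finset.mul_sum]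
    have := kk_lin hF 1 x one_ne_zero
    simp only [one_mul] at this
    simp_rw [add_comm x]
    rw [this, mul_zero]
  have sxx : ∑ x, quadraticChar F (x * (x + 1)) = -1 := by
    have := kk_quad hF 1 1 0 one_ne_zero
    simp [-quadraticChar_apply] at this
    rw [← this]
    refine Finset.sum_congr rfl fun x _ => ?_
    congr 1
    ring
  have s1 : ∑ n : F, kkL n * quadraticChar F n = 1 := by
    unfold kkL
    simp_rw [Finset.sum_mul]
    rw [Finset.sum_comm]
    have : ∀ x : F, ∑ n, quadraticChar F (x * (x + 1) * (x + n)) * quadraticChar F n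
        = - quadraticChar F (x * (x + 1)) := by
      intro x
      by_cases hx : x = 0
      · simp [hx]
      · have := kk_quad hF 1 x 0 one_ne_zero
        simp [-quadraticChar_apply, hx] at this
        have e : ∀ n, quadraticChar F (x * (x + 1) * (x + n)) * quadraticChar F n =
          quadraticChar F (x * (x + 1)) * quadraticChar F (n ^ 2 + x * n) := by
          intro n
          rw [← map_mul, ← map_mul]
          congr 1
          ring
        simp_rw [e, ← Finset.mul_sum]
        rw [this]
        ring
    simp_rw [this]
    rw [Finset.sum_neg_distrib, sxx]
    ring
  have s2 : ∑ n : F, kkL n * quadraticChar F ((1 - c) * n + c) = quadraticChar F (1 - c)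
      + Fintype.card F * quadraticChar F (c * (1 - c)) := by
    unfold kkL
    simp_rw [Finset.sum_mul]
    rw [Finset.sum_comm]
    have : ∀ x : F, ∑ n, quadraticChar F (x * (x + 1) * (x + n)) *
          quadraticChar F ((1 - c) * n + c)
        = - quadraticChar F (1 - c) * quadraticChar F (x * (x + 1)) +
          if x = c / (1 - c) then Fintype.card F * quadraticChar F (c * (1 - c)) else 0 := by
      intro x
      have := kk_quad hF (1 - c) ((1 - c) * x + c) (c * x) hd
      have e : ∀ n, quadraticChar F (x * (x + 1) * (x + n)) * quadraticChar F ((1 - c) * n + c) =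
          quadraticChar F (x * (x + 1)) *
          quadraticChar F ((1 - c) * n ^ 2 + ((1 - c) * x + c) * n + c * x) := by
          intro n
          rw [← map_mul, ← map_mul]
          congr 1
          ring
      simp_rw [e, ← Finset.mul_sum]
      rw [this]
      have hh : ((1 - c) * x + c) ^ 2 - 4 * (1 - c) * (c * x) = 0 ↔ x = c / (1 - c) := by
        have : ((1 - c) * x + c) ^ 2 - 4 * (1 - c) * (c * x) = ((1 - c) * x - c) ^ 2 := by ring
        rw [this, sq_eq_zero_iff, eq_div_iff hd, sub_eq_zero, mul_comm]
      simp only [hh]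
      split_ifs with hx
      · have : quadraticChar F (x * (x + 1)) = quadraticChar F c := by
          apply kk_chi (1 - c) _ _ hd
          rw [hx]
          field_simp
          ring
        rw [this, map_mul]
        ring
      · ring
    simp_rw [this]
    rw [Finset.sum_add_distrib, ← Finset.mul_sum, sxx]
    simp
  have expand : ∀ n : F, kkL n * (1 + quadraticChar F n) * (1 + quadraticChar F ((1 - c) * n + c)) =
     kkL n + kkL n * quadraticChar F n + kkL n * quadraticChar F ((1 - c) * n + c) +
      kkL n * quadraticChar F (n * ((1 - c) * n + c)) := by
    intro n
    rw [map_mul]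
    ring
  simp_rw [expand]
  rw [Finset.sum_add_distrib, Finset.sum_add_distrib, Finset.sum_add_distrib, s0, s1, s2]
  simp only [inv_zero, mul_zero, zero_add, ne_eq, OfNat.ofNat_ne_zero, not_false_eq_true, zero_pow,
    kk_L1 hF, kk_M2 hF, hz, map_one]
  linear_combination -hsq

lemma kk_sumN (hF : ringChar F ≠ 2) (c : F) (hc : c ≠ 0) (hd : 1 - c ≠ 0) :
    ∑ r, kkN c r = quadraticChar F (-1) +
      ∑ n, kkL n * quadraticChar F (n * ((1 - c) * n + c)) := by
  rw [kk_sum_one 0 _ (fun r => kkM c (1 * r + c / r) - quadraticChar F (c * (1 - c)))]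
  · rw [Finset.sum_sub_distrib, kk_frac hF 1 c one_ne_zero hc, kk_N0 hF c hc hd]
    simp only [mul_one]
    rw [kk_sumM hF c hc hd]
    simp
    ring
  · intro r hr
    rw [one_mul]
    exact kk_NM hF c r hc hd hr

lemma kk_sumU (hF : ringChar F ≠ 2) (c : F) (hc : c ≠ 0) (hd : 1 - c ≠ 0) :
    ∑ s : F, ∑ P : F, quadraticChar F (P * (s ^ 2 - 4 * P) *
      (c * s ^ 2 - 2 * (P + c) * s + (P - c) ^ 2 + 4 * P)) =
    ∑ n, kkL n * quadraticChar F (n * ((1 - c) * n + c)) := by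
  have h2 : (2 : F) ≠ 0 := Ring.two_ne_zero hF
  have h4 := kk_four hF
  have hm1 : quadraticChar F (-4) = quadraticChar F (-1) :=
    (kk_chi 2 _ _ h2 (by ring)).symm
  have z0 : ∑ P : F, quadraticChar F (P * (0 ^ 2 - 4 * P) *
      (c * 0 ^ 2 - 2 * (P + c) * 0 + (P - c) ^ 2 + 4 * P)) = - 2 * quadraticChar F (-1) := by
    rw [kk_sum_one 0 _ (fun P => quadraticChar F ((-1) * P ^ 2 + (2 * c - 4) * P + (- c ^ 2))),
      kk_quad hF _ _ _ (by simp)]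
    · have : (2 * c - 4) ^ 2 - 4 * (-1) * (- c ^ 2) ≠ 0 := by
        have : (2 * c - 4) ^ 2 - 4 * (-1) * (- c ^ 2) = 4 * 4 * (1 - c) := by ring
        rw [this]
        exact mul_ne_zero (mul_ne_zero h4 h4) hd
      rw [if_neg this]
      have : quadraticChar F (- c ^ 2) = quadraticChar F (-1) :=
        (kk_chi c _ _ hc (by ring)).symm
      simp [this]
      ring
    · intro P hP
      symm
      refine kk_chi (2 * P) _ _ (mul_ne_zero h2 hP) (by ring)
  rw [kk_sum_one 0 _ (fun s => ∑ w, quadraticChar F (w * (1 - 4 * w)) *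
    quadraticChar F ((w * s + c / s - 1) ^ 2 - (1 - c) * (1 - 4 * w)))]
  swap
  · intro s hs
    rw [← kk_sum_aff (s ^ 2) 0 (pow_ne_zero 2 hs)]
    refine Finset.sum_congr rfl fun w _ => ?_
    rw [← map_mul]
    symm
    refine kk_chi (s ^ 3) _ _ (pow_ne_zero _ hs) ?_
    field_simp
    ring
  rw [z0, Finset.sum_comm]
  have key : ∀ w : F, ∑ s, quadraticChar F (w * (1 - 4 * w)) *
      quadraticChar F ((w * s + c / s - 1) ^ 2 - (1 - c) * (1 - 4 * w)) =
      quadraticChar F (w * (1 - 4 * w)) * quadraticChar F ((w * 0 + c / 0 - 1) ^ 2 - (1 - c) * (1 - 4 * w))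
      - quadraticChar F (w * (1 - 4 * w)) +
      ∑ r, quadraticChar F ((4 * w) * (1 - 4 * w) * ((r - 1) ^ 2 - (1 - c) * (1 - 4 * w)) *
        (r ^ 2 - c * (4 * w))) := by
    intro w
    by_cases hw : w = 0
    · simp [hw]
    by_cases hw' : 1 - 4 * w = 0
    · simp [hw']
    rw [← Finset.mul_sum, kk_frac hF w c hw hc
      (fun r => quadraticChar F ((r - 1) ^ 2 - (1 - c) * (1 - 4 * w)))]
    simp_rw [mul_add _ (1 : ℤ), mul_one, Finset.sum_add_distrib]
    have q := kk_quad hF 1 (-2) (1 - (1 - c) * (1 - 4 * w)) one_ne_zero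
    have hne : (-2) ^ 2 - 4 * 1 * (1 - (1 - c) * (1 - 4 * w)) ≠ 0 := by
      have : (-2) ^ 2 - 4 * 1 * (1 - (1 - c) * (1 - 4 * w)) = 4 * (1 - c) * (1 - 4 * w) := by ring
      rw [this]
      exact mul_ne_zero (mul_ne_zero h4 hd) hw'
    rw [if_neg hne] at q
    have q' : ∑ r, quadraticChar F ((r - 1) ^ 2 - (1 - c) * (1 - 4 * w)) = -1 := by
      simp only [map_one] at q
      norm_num [-quadraticChar_apply] at q
      rw [← q]
      refine Finset.sum_congr rfl fun x _ => ?_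
      congr 1
      ring
    rw [q', mul_add, mul_add, Finset.mul_sum]
    have : ∀ r, quadraticChar F (w * (1 - 4 * w)) *
      (quadraticChar F ((r - 1) ^ 2 - (1 - c) * (1 - 4 * w)) * quadraticChar F (r ^ 2 - 4 * w * c)) =
      quadraticChar F ((4 * w) * (1 - 4 * w) * ((r - 1) ^ 2 - (1 - c) * (1 - 4 * w)) *
        (r ^ 2 - c * (4 * w))) := by
      intro r
      rw [← map_mul, ← map_mul]
      exact kk_chi 2 _ _ h2 (by ring)
    simp_rw [this]
    simp
    ring
  simp_rw [key]
  rw [Finset.sum_add_distrib, Finset.sum_sub_distrib]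
  have sw : ∑ w, quadraticChar F (w * (1 - 4 * w)) = - quadraticChar F (-1) := by
    have := kk_quad hF (-4) 1 0 (by simpa using h4)
    simp only [mul_zero, sub_zero, one_pow, one_ne_zero, if_false, hm1] at this
    rw [mul_comm, add_zero] at this
    rw [neg_one_mul] at this
    rw [← this]
    refine Finset.sum_congr rfl fun x _ => ?_
    congr 1
    ring
  have sN : ∑ w, ∑ r, quadraticChar F ((4 * w) * (1 - 4 * w) *
      ((r - 1) ^ 2 - (1 - c) * (1 - 4 * w)) * (r ^ 2 - c * (4 * w))) = ∑ r, kkN c r := by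
    rw [Finset.sum_comm]
    refine Finset.sum_congr rfl fun r _ => ?_
    unfold kkN
    have := kk_sum_aff 4 0 h4 (fun v => quadraticChar F (v * (1 - v) *
      ((r - 1) ^ 2 - (1 - c) * (1 - v)) * (r ^ 2 - c * v)))
    simpa only [add_zero] using this
  rw [sw, sN, kk_sumN hF c hc hd]
  ring

lemma kk_asq (hF : ringChar F ≠ 2) (c : F) (hc : c ≠ 0) (hd : 1 - c ≠ 0) :
    (∑ x, quadraticChar F (x ^ 3 - 2 * x ^ 2 + c * x)) ^ 2 = Fintype.card F +
    ∑ n, kkL n * quadraticChar F (n * ((1 - c) * n + c)) := by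
  rw [← kk_sumU hF c hc hd, sq, Finset.sum_mul_sum]
  have e1 : ∀ x, ∑ z, quadraticChar F (x ^ 3 - 2 * x ^ 2 + c * x) *
      quadraticChar F (z ^ 3 - 2 * z ^ 2 + c * z) =
      ∑ s, quadraticChar F ((x * (s - x)) * (c * s ^ 2 - 2 * (x * (s - x) + c) * s +
        (x * (s - x) - c) ^ 2 + 4 * (x * (s - x)))) := by
    intro x
    rw [← kk_sum_aff 1 (-x) one_ne_zero]
    refine Finset.sum_congr rfl fun s _ => ?_
    rw [← map_mul]
    congr 1
    ring
  simp_rw [e1]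
  rw [Finset.sum_comm]
  have e2 : ∀ s : F, ∑ x, quadraticChar F ((x * (s - x)) * (c * s ^ 2 - 2 * (x * (s - x) + c) * s +
        (x * (s - x) - c) ^ 2 + 4 * (x * (s - x)))) =
      ∑ P, quadraticChar F (P * (c * s ^ 2 - 2 * (P + c) * s + (P - c) ^ 2 + 4 * P)) +
      ∑ P, quadraticChar F (P * (s ^ 2 - 4 * P) *
        (c * s ^ 2 - 2 * (P + c) * s + (P - c) ^ 2 + 4 * P)) := by
    intro s
    rw [kk_fib univ (fun x => x * (s - x)) (fun P => 1 + quadraticChar F (s ^ 2 - 4 * P))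
      (fun P => quadraticChar F (P * (c * s ^ 2 - 2 * (P + c) * s + (P - c) ^ 2 + 4 * P)))]
    · rw [← Finset.sum_add_distrib]
      refine Finset.sum_congr rfl fun P _ => ?_
      simp only [map_mul]
      ring
    · intro P
      have := kk_roots hF 1 (-s) P one_ne_zero
      rw [neg_sq, mul_one] at this
      rw [← this]
      congr 2
      ext x
      simp only [mem_filter, mem_univ, true_and]
      constructor <;> intro h <;> linear_combination -h
  simp_rw [e2]
  rw [Finset.sum_add_distrib]
  congr 1
  rw [Finset.sum_comm]
  have e3 : ∀ P, ∑ s, quadraticChar F (P * (c * s ^ 2 - 2 * (P + c) * s + (P - c) ^ 2 + 4 * P)) =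
      - quadraticChar F c * quadraticChar F P + if P = c then (Fintype.card F : ℤ) else 0 := by
    intro P
    have := kk_quad hF c (-2 * (P + c)) ((P - c) ^ 2 + 4 * P) hc
    have hh : (-2 * (P + c)) ^ 2 - 4 * c * ((P - c) ^ 2 + 4 * P) = 0 ↔ P = c := by
      have h4 := kk_four hF
      have : (-2 * (P + c)) ^ 2 - 4 * c * ((P - c) ^ 2 + 4 * P) = 4 * (1 - c) * (P - c) ^ 2 := by
        ring
      rw [this]
      simp [h4, hd, sub_eq_zero]
    simp only [hh] at this
    have e : ∀ s, quadraticChar F (P * (c * s ^ 2 - 2 * (P + c) * s + (P - c) ^ 2 + 4 * P)) =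
       quadraticChar F P * quadraticChar F (c * s ^ 2 + -2 * (P + c) * s + ((P - c) ^ 2 + 4 * P)) := by
      intro s
      rw [← map_mul]
      congr 1
      ring
    simp_rw [e]
    rw [← Finset.mul_sum, this]
    have hsq : quadraticChar F c * quadraticChar F c = 1 := by
      rw [← sq]; exact quadraticChar_sq_one hc
    split_ifs with h
    · subst h
      linear_combination (Fintype.card F : ℤ) * hsq
    · ring
  simp_rw [e3]
  rw [Finset.sum_add_distrib, ← Finset.mul_sum, quadraticChar_sum_zero hF]
  simp

/-- Point count of a double cover. -/
lemma kk_count (hF : ringChar F ≠ 2) {ι : Type*} [Fintype ι] (f : ι → F) :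
    (Nat.card {v : F × ι // v.1 ^ 2 = f v.2} : ℤ) =
      Fintype.card ι + ∑ i, quadraticChar F (f i) := by
  classical
  rw [Nat.card_eq_fintype_card, Fintype.card_subtype]
  have : #{v : F × ι | v.1 ^ 2 = f v.2} = ∑ i, #({x : F | x ^ 2 = f i} : Set F).toFinset := by
    rw [Finset.card_filter, Fintype.sum_prod_type_right]
    refine Finset.sum_congr rfl fun i _ => ?_
    rw [← Finset.card_filter]
    congr 1
    ext x
    simp
  rw [this]
  push_cast
  simp_rw [quadraticChar_card_sqrts hF]
  rw [Finset.sum_add_distrib]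
  simp
  ring

end helpers

/-- Corollary 3.12 of the paper.
Let `p` be an odd prime, `φ` the quadratic character of `F_p`, and `λ ∈ F_p` with
`λ ≠ 0, -1`; let `a = p − #{(x,y) : y² = x³ − 2x² + (λ/(λ+1))x}`.  Then the number of
`(t,y₁,y₂,y₄,y₅) ∈ F_p⁵` with
`t² = λ·y₁·y₂·(λ+y₁)·(y₁+y₂)·(y₂+1)·y₄·y₅·(1+y₄)·(y₄+y₅)·(y₅+λ)` equals
`p⁴ + φ(λ)·(a² − p)²`. -/
theorem statement4 (p : ℕ) [Fact p.Prime] (hodd : Odd p)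
    (lam : ZMod p) (h0 : lam ≠ 0) (h1 : lam ≠ -1)
    (a : ℤ)
    (ha : a = p - Nat.card {xy : ZMod p × ZMod p //
      xy.2 ^ 2 = xy.1 ^ 3 - 2 * xy.1 ^ 2 + (lam / (lam + 1)) * xy.1}) :
    (Nat.card {v : ZMod p × ZMod p × ZMod p × ZMod p × ZMod p //
        v.1 ^ 2 = lam * v.2.1 * v.2.2.1 * (lam + v.2.1) * (v.2.1 + v.2.2.1) * (v.2.2.1 + 1) *
          v.2.2.2.1 * v.2.2.2.2 * (1 + v.2.2.2.1) * (v.2.2.2.1 + v.2.2.2.2) *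
          (v.2.2.2.2 + lam)} : ℤ) =
      p ^ 4 + quadraticChar (ZMod p) lam * (a ^ 2 - p) ^ 2 := by
  classical
  have hp2 : ringChar (ZMod p) ≠ 2 := by
    rw [ZMod.ringChar_zmod_n]
    rintro rfl
    exact absurd hodd (by decide)
  have hl : lam + 1 ≠ 0 := fun h => h1 (eq_neg_of_add_eq_zero_left h)
  set c := lam / (lam + 1) with hc
  have hc0 : c ≠ 0 := div_ne_zero h0 hl
  have hdd : 1 - c = 1 / (lam + 1) := by
    rw [hc]
    field_simp
    ring
  have hd : 1 - c ≠ 0 := by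
    rw [hdd]
    exact one_div_ne_zero hl
  have hlam : lam * (1 - c) = c := by
    rw [hdd, hc]
    ring
  have A := kk_asq hp2 c hc0 hd
  set T := ∑ n, kkL n * quadraticChar (ZMod p) (n * ((1 - c) * n + c)) with hT
  rw [(kk_sum_inj id Function.injective_id
      (fun x => quadraticChar (ZMod p) (x ^ 3 - 2 * x ^ 2 + c * x))).symm] at A
  have C1 := kk_count hp2 (fun x : ZMod p => x ^ 3 - 2 * x ^ 2 + c * x)
  have C1' : Nat.card {xy : ZMod p × ZMod p // xy.2 ^ 2 = xy.1 ^ 3 - 2 * xy.1 ^ 2 + c * xy.1} =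
      Nat.card {v : ZMod p × ZMod p // v.1 ^ 2 = v.2 ^ 3 - 2 * v.2 ^ 2 + c * v.2} :=
    Nat.card_congr ((Equiv.prodComm _ _).subtypeEquiv (fun _ => Iff.rfl))
  rw [C1', C1] at ha
  simp only [ZMod.card, id] at ha A
  have hA : a ^ 2 - p = T := by
    rw [ha]
    linear_combination A
  rw [hA]
  have C2 := kk_count hp2 (fun w : ZMod p × ZMod p × ZMod p × ZMod p =>
    lam * w.1 * w.2.1 * (lam + w.1) * (w.1 + w.2.1) * (w.2.1 + 1) *
          w.2.2.1 * w.2.2.2 * (1 + w.2.2.1) * (w.2.2.1 + w.2.2.2) * (w.2.2.2 + lam))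
  rw [C2]
  simp only [Fintype.card_prod, ZMod.card, Fintype.sum_prod_type]
  set S := ∑ x : ZMod p, ∑ y : ZMod p,
    quadraticChar (ZMod p) (x * y * (lam + x) * (x + y) * (y + 1)) with hS
  have hTS : T = quadraticChar (ZMod p) (1 - c) * S := by
    rw [hT, hS, Finset.mul_sum]
    refine Finset.sum_congr rfl fun x _ => ?_
    unfold kkL
    rw [Finset.mul_sum, Finset.sum_mul]
    refine Finset.sum_congr rfl fun y _ => ?_
    rw [← map_mul, ← map_mul]
    congr 1
    linear_combination (-(y * (y + 1) * (y + x) * x)) * hlam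
  have hsq : quadraticChar (ZMod p) (1 - c) ^ 2 = 1 := quadraticChar_sq_one hd
  have hSS : T ^ 2 = S * S := by
    rw [hTS, mul_pow, hsq]
    ring
  have hS2 : S = ∑ x : ZMod p, ∑ y : ZMod p,
    quadraticChar (ZMod p) (x * y * (1 + x) * (x + y) * (y + lam)) := by
    rw [hS, Finset.sum_comm]
    refine Finset.sum_congr rfl fun y _ => Finset.sum_congr rfl fun x _ => ?_
    congr 1
    ring
  rw [hSS]
  congr 1
  · push_cast
    ring
  · nth_rewrite 2 [hS2]
    rw [hS, Finset.sum_mul, Finset.mul_sum]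
    refine Finset.sum_congr rfl fun x _ => ?_
    rw [Finset.sum_mul, Finset.mul_sum]
    refine Finset.sum_congr rfl fun y _ => ?_
    rw [Finset.mul_sum, Finset.mul_sum]
    refine Finset.sum_congr rfl fun z _ => ?_
    rw [Finset.mul_sum, Finset.mul_sum]
    refine Finset.sum_congr rfl fun t _ => ?_
    rw [← map_mul, ← map_mul]
    congr 1
    ring
end

section
/- Let p be an odd prime. Then #{(t,x_0,x_1,x_2,x_3,x_4,x_5) ∈ F_p^7 : (x_0,…,x_5) ≠ (0,…,0) and t^2 = x_0·x_1·x_2·x_3·x_4·x_5·(x_0+x_1)·(x_3+x_5)·(x_2+x_4+x_5)·(x_0+x_2−x_4)·(x_1−x_2+x_4)·(x_2−x_3+x_4)} = (p−1)·(p^5 + p^4 + p^3 + p^2 + p + 1 − a_6 − p·a_4 − 2p^2·a_2). -/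
open scoped BigOperators

namespace V32
open Finset

variable {F : Type*} [Field F] [Fintype F] [DecidableEq F]

local notation "χ" => quadraticChar F

lemma chi_eq {A B : F} (c : F) (hc : c ≠ 0) (h : A = B * c ^ 2) : χ A = χ B := by
  rw [h, map_mul, quadraticChar_sq_one' hc, mul_one]

lemma chi_mul_self {c : F} (hc : c ≠ 0) : χ c * χ c = 1 := by
  rw [← map_mul, ← pow_two, quadraticChar_sq_one' hc]

lemma sum_aff (a b : F) (ha : a ≠ 0) (h : F → ℤ) : ∑ x, h (a * x + b) = ∑ x, h x := by
  refine Function.Bijective.sum_comp (g := h) (e := fun x => a * x + b) ?_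
  refine Finite.injective_iff_bijective.1 fun x y hxy => ?_
  exact mul_left_cancel₀ ha (add_right_cancel hxy)

lemma sum_mulc (a : F) (ha : a ≠ 0) (h : F → ℤ) : ∑ x, h (a * x) = ∑ x, h x := by
  simpa using sum_aff a 0 ha h

lemma sum_addc (b : F) (h : F → ℤ) : ∑ x, h (x + b) = ∑ x, h x := by
  simpa using sum_aff 1 b one_ne_zero h

lemma sum_invc (h : F → ℤ) : ∑ x, h (x⁻¹) = ∑ x, h x :=
  Function.Bijective.sum_comp (inv_involutive (G := F)).bijective h

lemma sum_sq_comp (hF : ringChar F ≠ 2) (h : F → ℤ) :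
    ∑ x, h (x ^ 2) = ∑ a, h a * (1 + χ a) := by
  rw [← Finset.sum_fiberwise (s := univ) (g := fun x : F => x ^ 2)]
  refine Finset.sum_congr rfl fun a _ => ?_
  rw [Finset.sum_congr rfl (g := fun _ => h a)
    (fun x hx => by rw [(Finset.mem_filter.1 hx).2])]
  rw [Finset.sum_const, nsmul_eq_mul, mul_comm]
  congr 1
  have := quadraticChar_card_sqrts hF a
  rw [add_comm, ← this]
  congr 2
  ext x
  simp

lemma two_ne (hF : ringChar F ≠ 2) : (2 : F) ≠ 0 := Ring.two_ne_zero hF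

/-- substitution `V ↦ V² + d V` -/
lemma sum_quad_comp (hF : ringChar F ≠ 2) (h : F → ℤ) (d : F) :
    ∑ x, h (x ^ 2 + d * x) = ∑ m, h m * (1 + χ (d ^ 2 + 4 * m)) := by
  have h2 := two_ne hF
  have h4 : (4 : F) ≠ 0 := by
    have : (4 : F) = 2 * 2 := by norm_num
    rw [this]; exact mul_ne_zero h2 h2
  have e1 : ∑ x, h (x ^ 2 + d * x) = ∑ x, h ((x ^ 2 - d ^ 2) / 4) := by
    conv_rhs => rw [← sum_aff 2 d h2]
    refine Finset.sum_congr rfl fun x _ => ?_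
    congr 1
    field_simp
    ring
  rw [e1, sum_sq_comp hF (fun a => h ((a - d ^ 2) / 4)), ← sum_aff 4 (d ^ 2) h4]
  refine Finset.sum_congr rfl fun x _ => ?_
  congr 2
  · field_simp; ring
  · ring_nf

/-- substitution `f ↦ f + 1/f` -/
lemma sum_inv_comp (hF : ringChar F ≠ 2) (h : F → ℤ) :
    ∑ f ∈ univ.filter (fun f : F => f ≠ 0), h (f + f⁻¹) = ∑ n, h n * (1 + χ (n ^ 2 - 4)) := by
  have h2 := two_ne hF
  rw [← Finset.sum_fiberwise (g := fun x : F => x + x⁻¹)]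
  refine Finset.sum_congr rfl fun n _ => ?_
  rw [Finset.sum_congr rfl (g := fun _ => h n)
    (fun x hx => by rw [(Finset.mem_filter.1 hx).2])]
  rw [Finset.sum_const, nsmul_eq_mul, mul_comm]
  congr 1
  rw [add_comm, ← quadraticChar_card_sqrts hF (n ^ 2 - 4)]
  congr 1
  refine Finset.card_bij (fun f _ => 2 * f - n) ?_ ?_ ?_
  · intro f hf
    simp only [mem_filter, mem_univ, true_and] at hf
    obtain ⟨h0, h1⟩ := hf
    simp only [Set.mem_toFinset, Set.mem_ofPred_eq]
    rw [← h1]; field_simp; ring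
  · intro a _ b _ hab
    exact mul_left_cancel₀ h2 (sub_left_inj.1 hab)
  · intro x hx
    simp only [Set.mem_toFinset, Set.mem_ofPred_eq] at hx
    have key : ((x + n) / 2) * (n - (x + n) / 2) = 1 := by
      field_simp
      linear_combination (-1 : F) * hx
    refine ⟨(x + n) / 2, ?_, ?_⟩
    · simp only [mem_filter, mem_univ, true_and]
      refine ⟨left_ne_zero_of_mul_eq_one key, ?_⟩
      rw [inv_eq_of_mul_eq_one_right key]; ring
    · field_simp; ring

lemma sum_chi (hF : ringChar F ≠ 2) : ∑ a : F, χ a = 0 := quadraticChar_sum_zero hF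

lemma sum_chi_affine (hF : ringChar F ≠ 2) (a b : F) (ha : a ≠ 0) :
    ∑ x : F, χ (a * x + b) = 0 := by
  rw [← sum_chi (F := F) hF, sum_aff a b ha (fun x => χ x)]

lemma sum_chi_shift (hF : ringChar F ≠ 2) (c : F) (hc : c ≠ 0) :
    ∑ z : F, χ (z * (z + c)) = -1 := by
  have h1 : ∑ z : F, χ (z * (z + c)) = ∑ w : F, (χ (c * w + 1) - if w = 0 then 1 else 0) := by
    rw [← sum_invc]
    refine Finset.sum_congr rfl fun z _ => ?_
    by_cases hz : z = 0
    · simp [hz]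
    · simp only [hz, if_false, sub_zero]
      exact chi_eq z⁻¹ (inv_ne_zero hz) (by field_simp; ring)
  rw [h1, Finset.sum_sub_distrib, sum_chi_affine hF c 1 hc]
  simp

lemma sum_chi_two (hF : ringChar F ≠ 2) (a b : F) :
    ∑ k : F, χ ((k + a) * (k + b)) = (if a = b then (Fintype.card F : ℤ) else 0) - 1 := by
  split_ifs with h
  · subst h
    have : ∑ k : F, χ ((k + a) * (k + a)) = ∑ z : F, ((1 : ℤ) - if z = 0 then 1 else 0) := by
      rw [sum_addc a (fun k => χ (k * k))]
      refine Finset.sum_congr rfl fun k _ => ?_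
      by_cases hz : k = 0
      · simp [hz]
      · rw [map_mul, chi_mul_self hz, if_neg hz, sub_zero]
    rw [this, Finset.sum_sub_distrib]; simp
  · rw [zero_sub, ← sum_chi_shift hF (b - a) (sub_ne_zero.2 (Ne.symm h))]
    rw [← sum_addc a (fun z => χ (z * (z + (b - a))))]
    refine Finset.sum_congr rfl fun k _ => ?_
    ring_nf

/-- The Jacobsthal-type sum. -/
def S (k : F) : ℤ := ∑ x : F, χ (x * (x ^ 2 + k))

lemma S_scale (k y : F) (hy : y ≠ 0) : S (k * y ^ 2) = χ y * S k := by
  unfold S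
  rw [Finset.mul_sum, ← sum_mulc y hy]
  refine Finset.sum_congr rfl fun x _ => ?_
  rw [← map_mul]
  exact chi_eq y hy (by ring)

lemma S_zero (hF : ringChar F ≠ 2) : S (0 : F) = 0 := by
  unfold S
  rw [← sum_chi (F := F) hF]
  refine Finset.sum_congr rfl fun x _ => ?_
  by_cases hx : x = 0
  · simp [hx]
  · exact chi_eq x hx (by ring)

lemma S_sq (k : F) : S k ^ 2 = ∑ x : F, ∑ y : F, χ (x * y) * χ ((k + x ^ 2) * (k + y ^ 2)) := by
  unfold S
  rw [pow_two, Finset.sum_mul_sum]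
  refine Finset.sum_congr rfl fun x _ => Finset.sum_congr rfl fun y _ => ?_
  simp only [← map_mul]; ring_nf

lemma sum_S_sq (hF : ringChar F ≠ 2) (h1 : χ (-1) = 1) :
    ∑ k : F, S k ^ 2 = 2 * Fintype.card F * (Fintype.card F - 1 : ℤ) := by
  have h2 := two_ne hF
  simp_rw [S_sq]
  rw [Finset.sum_comm]
  have : ∀ x : F, ∑ k : F, ∑ y : F, χ (x * y) * χ ((k + x ^ 2) * (k + y ^ 2))
      = if x = 0 then 0 else 2 * (Fintype.card F : ℤ) := by
    intro x
    split_ifs with hx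
    · simp [hx]
    rw [Finset.sum_comm]
    simp_rw [← Finset.mul_sum, sum_chi_two hF, mul_sub, Finset.sum_sub_distrib]
    have e0 : ∑ y : F, χ (x * y) * 1 = 0 := by
      simpa using sum_chi_affine hF x 0 hx
    rw [e0, sub_zero]
    have hne : x ≠ -x := by
      intro h
      have : 2 * x = 0 := by linear_combination h
      rcases mul_eq_zero.1 this with h | h
      · exact h2 h
      · exact hx h
    have e1 : ∀ y : F, χ (x * y) * (if x ^ 2 = y ^ 2 then (Fintype.card F : ℤ) else 0)
        = (if y = x then (Fintype.card F : ℤ) else 0) + (if y = -x then (Fintype.card F : ℤ) else 0) := by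
      intro y
      by_cases ha : y = x
      · subst ha; rw [map_mul, chi_mul_self hx]; simp [hne]
      by_cases hb : y = -x
      · subst hb
        have : x * -x = -1 * x ^ 2 := by ring
        rw [chi_eq x hx this, h1]
        simp [ha]
      · have : ¬ x ^ 2 = y ^ 2 := by
          intro h
          rcases sq_eq_sq_iff_eq_or_eq_neg.1 h with h | h
          · exact ha h.symm
          · exact hb (by rw [h, neg_neg])
        simp [ha, hb, this]
    simp_rw [e1]
    rw [Finset.sum_add_distrib]; simp; ring
  simp_rw [this]
  rw [Finset.sum_ite]
  simp [Finset.filter_ne', Finset.card_univ]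
  rw [Nat.cast_sub Fintype.card_pos]; push_cast; ring

def W (F : Type*) [Field F] [Fintype F] [DecidableEq F] : ℤ :=
  ∑ x : F, ∑ k : F, quadraticChar F (x * k * (k + 1) * (k + x ^ 2))

lemma sum_ne_zero_const (c : ℤ) :
    ∑ y : F, (if y = 0 then 0 else c) = (Fintype.card F - 1 : ℤ) * c := by
  have : ∀ y : F, (if y = 0 then 0 else c) = c - if y = 0 then c else 0 := fun y => by
    split_ifs <;> simp
  simp_rw [this]
  rw [Finset.sum_sub_distrib]
  simp; ring

lemma sum_chi_S_sq :
    ∑ k : F, χ k * S k ^ 2 = (Fintype.card F - 1 : ℤ) * W F := by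
  rw [← sum_ne_zero_const (F := F)]
  simp_rw [S_sq, Finset.mul_sum]
  rw [Finset.sum_comm]
  have : ∑ x : F, ∑ k : F, ∑ y : F, χ k * (χ (x * y) * χ ((k + x ^ 2) * (k + y ^ 2)))
     = ∑ y : F, ∑ x : F, ∑ k : F, χ k * (χ (x * y) * χ ((k + x ^ 2) * (k + y ^ 2))) := by
    rw [Finset.sum_comm (s := (univ : Finset F)) (t := (univ : Finset F))
      (f := fun y x => ∑ k : F, χ k * (χ (x * y) * χ ((k + x ^ 2) * (k + y ^ 2))))]
    exact Finset.sum_congr rfl fun x _ => Finset.sum_comm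
  rw [this]
  refine Finset.sum_congr rfl fun y _ => ?_
  split_ifs with hy
  · simp [hy]
  unfold W
  rw [← sum_mulc y hy]
  refine Finset.sum_congr rfl fun x _ => ?_
  rw [← sum_mulc (y ^ 2) (pow_ne_zero 2 hy)]
  refine Finset.sum_congr rfl fun k _ => ?_
  simp only [← map_mul]
  exact chi_eq (y ^ 4) (pow_ne_zero _ hy) (by ring)

lemma W_eq (hF : ringChar F ≠ 2) (h1 : χ (-1) = 1) : W F = S (1 : F) ^ 2 - 2 * Fintype.card F := by
  have e1 := sum_S_sq hF h1
  have e2 := sum_chi_S_sq (F := F)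
  have e3 := sum_sq_comp hF (fun k => S k ^ 2)
  have e4 : ∑ y : F, S (y ^ 2) ^ 2 = (Fintype.card F - 1 : ℤ) * S (1 : F) ^ 2 := by
    rw [← sum_ne_zero_const (F := F)]
    refine Finset.sum_congr rfl fun y _ => ?_
    split_ifs with hy
    · simp [hy, S_zero hF]
    · have := S_scale 1 y hy
      rw [one_mul] at this
      rw [this, mul_pow, pow_two (χ y), chi_mul_self hy, one_mul]
  have e5 : ∑ a : F, S a ^ 2 * (1 + χ a) = ∑ k : F, S k ^ 2 + ∑ k : F, χ k * S k ^ 2 := by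
    rw [← Finset.sum_add_distrib]
    exact Finset.sum_congr rfl fun _ _ => by ring
  have hc : (Fintype.card F - 1 : ℤ) ≠ 0 := by
    have := Fintype.one_lt_card (α := F)
    omega
  apply mul_left_cancel₀ hc
  rw [← e2]
  linear_combination -e5 - e1 + e4 - e3

def A (u : F) : ℤ := ∑ x : F, ∑ y : F, χ (x * y * (x + y) * (x + u) * (y - u))

lemma A_one_step1 (hF : ringChar F ≠ 2) :
    A (1 : F) = ∑ d : F, ∑ V : F,
      χ (2 * d * (((V ^ 2 + d * V) - 1) ^ 2 - d ^ 2)) := by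
  have h2 := two_ne hF
  have e1 : A (1 : F) = ∑ U : F, ∑ V : F, χ (2 * (U ^ 2 - 1) * (V ^ 2 - 1) * (U - V)) := by
    unfold A
    conv_rhs => rw [← sum_aff 2 1 h2]
    refine Finset.sum_congr rfl fun x _ => ?_
    conv_rhs => rw [← sum_aff (-2) 1 (neg_ne_zero.2 h2)]
    refine Finset.sum_congr rfl fun y _ => ?_
    refine (chi_eq 8 ?_ (by ring)).symm
    have : (8 : F) = 2 ^ 3 := by norm_num
    rw [this]; exact pow_ne_zero _ h2
  rw [e1, Finset.sum_comm]
  conv_rhs => rw [Finset.sum_comm]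
  refine Finset.sum_congr rfl fun V _ => ?_
  rw [← sum_addc V]
  refine Finset.sum_congr rfl fun d _ => ?_
  ring_nf

lemma A_one_step2 (hF : ringChar F ≠ 2) :
    A (1 : F) = ∑ d : F, ∑ m : F, χ (2 * d * ((m - 1) ^ 2 - d ^ 2) * (d ^ 2 + 4 * m)) := by
  have h2 := two_ne hF
  rw [A_one_step1 hF]
  rw [Finset.sum_congr rfl (fun d _ =>
    sum_quad_comp hF (fun m => χ (2 * d * ((m - 1) ^ 2 - d ^ 2))) d)]
  simp_rw [mul_add, mul_one, Finset.sum_add_distrib, ← map_mul]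
  have e0 : ∑ d : F, ∑ m : F, χ (2 * d * ((m - 1) ^ 2 - d ^ 2)) = 0 := by
    have : ∀ d : F, ∑ m : F, χ (2 * d * ((m - 1) ^ 2 - d ^ 2)) = - χ (2 * d + 0) := by
      intro d
      by_cases hd : d = 0
      · simp [hd]
      have hne : ¬ (-1 - d = -1 + d) := by
        intro h
        have : 2 * d = 0 := by linear_combination -h
        rcases mul_eq_zero.1 this with h | h
        · exact h2 h
        · exact hd h
      have := sum_chi_two hF (-1 - d) (-1 + d)
      rw [if_neg hne] at this
      rw [add_zero, ← mul_neg_one, ← zero_sub (1 : ℤ), ← this, Finset.mul_sum]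
      refine Finset.sum_congr rfl fun m _ => ?_
      rw [← map_mul]; ring_nf
    simp_rw [this]
    rw [Finset.sum_neg_distrib, sum_chi_affine hF 2 0 h2, neg_zero]
  rw [e0, zero_add]
  refine Finset.sum_congr rfl fun d _ => Finset.sum_congr rfl fun m _ => ?_
  ring_nf

lemma A_one_step3 (hF : ringChar F ≠ 2) :
    A (1 : F) = ∑ e : F, ∑ n : F, χ (e * (n ^ 2 - 1) * (e ^ 2 + 2 * e * n + 1)) := by
  have h2 := two_ne hF
  rw [A_one_step2 hF, ← sum_mulc 2 h2]
  refine Finset.sum_congr rfl fun e _ => ?_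
  by_cases he : e = 0
  · simp [he]
  rw [← sum_aff (2 * e) 1 (mul_ne_zero h2 he)]
  refine Finset.sum_congr rfl fun n _ => ?_
  refine chi_eq (2 ^ 3 * e) (mul_ne_zero (pow_ne_zero _ h2) he) (by ring)

lemma step4 (hF : ringChar F ≠ 2) (e : F) (he : e ≠ 0) :
    ∑ n : F, χ (e * (n ^ 2 - 1) * (e ^ 2 + 2 * e * n + 1)) =
      ∑ f : F, χ ((e - f) * (e * f - 1) * (e * f)) := by
  have h2 := two_ne hF
  have key := sum_inv_comp hF (fun N => χ (e + e⁻¹ - N))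
  simp_rw [mul_add, mul_one, Finset.sum_add_distrib, ← map_mul] at key
  have e0 : ∑ N : F, χ (e + e⁻¹ - N) = 0 := by
    rw [← sum_chi_affine hF (-1) (e + e⁻¹) (neg_ne_zero.2 one_ne_zero)]
    exact Finset.sum_congr rfl fun N _ => by ring_nf
  rw [e0, zero_add] at key
  have e1 : ∑ n : F, χ (e * (n ^ 2 - 1) * (e ^ 2 + 2 * e * n + 1)) =
      ∑ N : F, χ ((e + e⁻¹ - N) * (N ^ 2 - 4)) := by
    conv_rhs => rw [← sum_mulc (-2) (neg_ne_zero.2 h2)]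
    refine Finset.sum_congr rfl fun n _ => ?_
    exact (chi_eq (2 / e) (div_ne_zero h2 he) (by field_simp; ring)).symm
  rw [e1, ← key, Finset.sum_filter]
  refine Finset.sum_congr rfl fun f _ => ?_
  by_cases hf : f = 0
  · simp [hf]
  · rw [if_pos hf]
    exact (chi_eq (e * f) (mul_ne_zero he hf) (by field_simp; ring)).symm

lemma A_one_eq_W (hF : ringChar F ≠ 2) (h1 : χ (-1) = 1) : A (1 : F) = W F := by
  have e1 : A (1 : F) = ∑ e : F, ∑ f : F, χ ((e - f) * (e * f - 1) * (e * f)) := by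
    rw [A_one_step3 hF]
    refine Finset.sum_congr rfl fun e _ => ?_
    by_cases he : e = 0
    · simp [he]
    · exact step4 hF e he
  rw [e1, Finset.sum_comm]
  unfold W
  refine Finset.sum_congr rfl fun f _ => ?_
  by_cases hf : f = 0
  · simp [hf]
  rw [← sum_mulc (-f) (neg_ne_zero.2 hf), ← sum_invc]
  refine Finset.sum_congr rfl fun k _ => ?_
  by_cases hk : k = 0
  · simp [hk]
  rw [chi_eq (B := -1 * (f * k * (k + 1) * (k + f ^ 2))) (f / k ^ 2)
    (div_ne_zero hf (pow_ne_zero _ hk)) (by field_simp; ring), map_mul, h1, one_mul]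

lemma A_scale (hF : ringChar F ≠ 2) (u : F) : A u = χ u * A (1 : F) := by
  by_cases hu : u = 0
  · subst hu
    rw [quadraticChar_zero, zero_mul]
    unfold A
    have : ∀ x : F, ∑ y : F, χ (x * y * (x + y) * (x + 0) * (y - 0)) = - χ x := by
      intro x
      by_cases hx : x = 0
      · simp [hx]
      have e : ∀ y : F, χ (x * y * (x + y) * (x + 0) * (y - 0)) =
          χ (1 * y + x) - if y = 0 then χ x else 0 := by
        intro y
        by_cases hy : y = 0
        · simp [hy]
        · simp only [hy, if_false, sub_zero, add_zero]
          exact chi_eq (B := 1 * y + x) (x * y) (mul_ne_zero hx hy) (by ring)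
      simp_rw [e]
      rw [Finset.sum_sub_distrib, sum_chi_affine hF 1 x one_ne_zero]
      simp
    simp_rw [this]
    rw [Finset.sum_neg_distrib, sum_chi hF, neg_zero]
  unfold A
  rw [Finset.mul_sum, ← sum_mulc u hu]
  refine Finset.sum_congr rfl fun x _ => ?_
  rw [Finset.mul_sum, ← sum_mulc u hu]
  refine Finset.sum_congr rfl fun y _ => ?_
  rw [← map_mul]
  exact chi_eq (u ^ 2) (pow_ne_zero _ hu) (by ring)

lemma B_eq (w : F) :
    ∑ x : F, ∑ y : F, χ (x * y * (x + y) * (w + y) * (w - x)) = χ (-1) * A w := by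
  unfold A
  rw [Finset.sum_comm, Finset.mul_sum]
  refine Finset.sum_congr rfl fun x _ => ?_
  rw [Finset.mul_sum]
  refine Finset.sum_congr rfl fun y _ => ?_
  rw [← map_mul]; ring_nf

def fpoly (x0 x1 x2 x3 x4 x5 : F) : F :=
  x0 * x1 * x2 * x3 * x4 * x5 * (x0 + x1) * (x3 + x5) * (x2 + x4 + x5) *
    (x0 + x2 - x4) * (x1 - x2 + x4) * (x2 - x3 + x4)

lemma sum_last : ∑ x2 : F, ∑ x4 : F, χ (x2 * x4 * (x2 - x4) * (x2 + x4)) =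
    (Fintype.card F - 1 : ℤ) * S (-1 : F) := by
  rw [← sum_ne_zero_const (F := F), Finset.sum_comm]
  refine Finset.sum_congr rfl fun y _ => ?_
  split_ifs with hy
  · simp [hy]
  unfold S
  rw [← sum_mulc y hy]
  refine Finset.sum_congr rfl fun x _ => ?_
  exact chi_eq (y ^ 2) (pow_ne_zero _ hy) (by ring)

lemma total (hF : ringChar F ≠ 2) :
    ∑ x2 : F, ∑ x4 : F, ∑ x0 : F, ∑ x1 : F, ∑ x3 : F, ∑ x5 : F, χ (fpoly x0 x1 x2 x3 x4 x5) =
      (Fintype.card F - 1 : ℤ) * (χ (-1) * A (1 : F) ^ 2 * S (-1 : F)) := by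
  have e : ∀ x2 x4 : F, ∑ x0 : F, ∑ x1 : F, ∑ x3 : F, ∑ x5 : F, χ (fpoly x0 x1 x2 x3 x4 x5) =
      χ (x2 * x4 * (x2 - x4) * (x2 + x4)) * (χ (-1) * A (1 : F) ^ 2) := by
    intro x2 x4
    have : χ (x2 * x4 * (x2 - x4) * (x2 + x4)) * (χ (-1) * A (1 : F) ^ 2) =
        χ (x2 * x4) * (A (x2 - x4) *
          ∑ x : F, ∑ y : F, χ (x * y * (x + y) * ((x2 + x4) + y) * ((x2 + x4) - x))) := by
      rw [B_eq, A_scale hF (x2 - x4), A_scale hF (x2 + x4), map_mul, map_mul]; ring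
    rw [this, A, Finset.sum_mul, Finset.mul_sum]
    refine Finset.sum_congr rfl fun x0 _ => ?_
    rw [Finset.sum_mul, Finset.mul_sum]
    refine Finset.sum_congr rfl fun x1 _ => ?_
    rw [Finset.mul_sum, Finset.mul_sum]
    refine Finset.sum_congr rfl fun x3 _ => ?_
    rw [Finset.mul_sum, Finset.mul_sum]
    refine Finset.sum_congr rfl fun x5 _ => ?_
    rw [← map_mul, ← map_mul]
    congr 1
    unfold fpoly; ring
  simp_rw [e, ← Finset.sum_mul, sum_last]
  ring

def tupEquiv (F : Type*) : (Fin 6 → F) ≃ F × F × F × F × F × F where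
  toFun v := (v 2, v 4, v 0, v 1, v 3, v 5)
  invFun t := ![t.2.2.1, t.2.2.2.1, t.1, t.2.2.2.2.1, t.2.1, t.2.2.2.2.2]
  left_inv v := by ext i; fin_cases i <;> rfl
  right_inv t := rfl

lemma sum_tuple (h : F → F → F → F → F → F → ℤ) :
    ∑ v : Fin 6 → F, h (v 0) (v 1) (v 2) (v 3) (v 4) (v 5) =
      ∑ x2 : F, ∑ x4 : F, ∑ x0 : F, ∑ x1 : F, ∑ x3 : F, ∑ x5 : F, h x0 x1 x2 x3 x4 x5 := by
  rw [Fintype.sum_equiv (tupEquiv F) (fun v => h (v 0) (v 1) (v 2) (v 3) (v 4) (v 5))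
    (fun t => h t.2.2.1 t.2.2.2.1 t.1 t.2.2.2.2.1 t.2.1 t.2.2.2.2.2) (fun v => rfl)]
  simp only [Fintype.sum_prod_type]

lemma card_sqrt (hF : ringChar F ≠ 2) (a : F) :
    (Nat.card {t : F // t ^ 2 = a} : ℤ) = 1 + χ a := by
  rw [add_comm, ← quadraticChar_card_sqrts hF a, Nat.card_eq_fintype_card, Fintype.card_subtype]
  congr 2
  ext x; simp

lemma card_curve (hF : ringChar F ≠ 2) :
    (Nat.card {xy : F × F // xy.2 ^ 2 = xy.1 ^ 3 - xy.1} : ℤ) = Fintype.card F + S (-1 : F) := by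
  have e : {xy : F × F // xy.2 ^ 2 = xy.1 ^ 3 - xy.1} ≃ Σ x : F, {t : F // t ^ 2 = x ^ 3 - x} :=
    { toFun := fun z => ⟨z.1.1, z.1.2, z.2⟩
      invFun := fun z => ⟨(z.1, z.2.1), z.2.2⟩
      left_inv := fun z => rfl
      right_inv := fun z => rfl }
  rw [Nat.card_congr e, Nat.card_sigma]
  push_cast
  simp_rw [card_sqrt hF]
  rw [Finset.sum_add_distrib]
  unfold S
  congr 1
  · simp
  · exact Finset.sum_congr rfl fun x _ => by ring_nf

lemma card_main (hF : ringChar F ≠ 2) (f : (Fin 6 → F) → F) (hf : f 0 = 0) :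
    (Nat.card {v : F × (Fin 6 → F) // v.2 ≠ 0 ∧ v.1 ^ 2 = f v.2} : ℤ) =
      (Fintype.card F : ℤ) ^ 6 - 1 + ∑ x, χ (f x) := by
  have e : {v : F × (Fin 6 → F) // v.2 ≠ 0 ∧ v.1 ^ 2 = f v.2} ≃
      Σ x : Fin 6 → F, {t : F // x ≠ 0 ∧ t ^ 2 = f x} :=
    { toFun := fun z => ⟨z.1.2, z.1.1, z.2⟩
      invFun := fun z => ⟨(z.2.1, z.1), z.2.2⟩
      left_inv := fun z => rfl
      right_inv := fun z => rfl }
  rw [Nat.card_congr e, Nat.card_sigma]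
  push_cast
  have h : ∀ x : Fin 6 → F, (Nat.card {t : F // x ≠ 0 ∧ t ^ 2 = f x} : ℤ) =
      1 + χ (f x) - if x = 0 then 1 else 0 := by
    intro x
    by_cases hx : x = 0
    · subst hx; simp [hf]
    · simp only [ne_eq, hx, not_false_eq_true, true_and, if_false, sub_zero]
      exact card_sqrt hF (f x)
  simp_rw [h]
  rw [Finset.sum_sub_distrib, Finset.sum_add_distrib]
  simp
  ring

end V32


/-- Theorem 4.2 of the paper.
Let `p` be an odd prime, `a₂ = p − #{(x,y) : y² = x³ − x}`, `a₃ = a₂² − 2p` if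
`p ≡ 1 (mod 4)`, `a₃ = 0` if `p ≡ 3 (mod 4)`, `a₄ = a₂·(a₃ − p)` and
`a₆ = a₄·a₃ − p²·a₂`.  Then the number of `(t,x₀,…,x₅) ∈ F_p⁷` with `(x₀,…,x₅) ≠ 0` and
`t² = x₀·x₁·x₂·x₃·x₄·x₅·(x₀+x₁)·(x₃+x₅)·(x₂+x₄+x₅)·(x₀+x₂−x₄)·(x₁−x₂+x₄)·(x₂−x₃+x₄)`
equals `(p−1)·(p⁵ + p⁴ + p³ + p² + p + 1 − a₆ − p·a₄ − 2p²·a₂)`. -/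
theorem statement15 (p : ℕ) [Fact p.Prime] (hodd : Odd p)
    (a2 : ℤ)
    (ha2 : a2 = p - Nat.card {xy : ZMod p × ZMod p // xy.2 ^ 2 = xy.1 ^ 3 - xy.1})
    (a3 : ℤ)
    (ha31 : p % 4 = 1 → a3 = a2 ^ 2 - 2 * p)
    (ha33 : p % 4 = 3 → a3 = 0)
    (a4 : ℤ) (ha4 : a4 = a2 * (a3 - p))
    (a6 : ℤ) (ha6 : a6 = a4 * a3 - p ^ 2 * a2) :
    (Nat.card {v : ZMod p × (Fin 6 → ZMod p) // v.2 ≠ 0 ∧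
        v.1 ^ 2 = v.2 0 * v.2 1 * v.2 2 * v.2 3 * v.2 4 * v.2 5 *
          (v.2 0 + v.2 1) * (v.2 3 + v.2 5) * (v.2 2 + v.2 4 + v.2 5) *
          (v.2 0 + v.2 2 - v.2 4) * (v.2 1 - v.2 2 + v.2 4) *
          (v.2 2 - v.2 3 + v.2 4)} : ℤ) =
      (p - 1) * (p ^ 5 + p ^ 4 + p ^ 3 + p ^ 2 + p + 1 - a6 - p * a4 - 2 * p ^ 2 * a2) := by
  classical
  have hp := Fact.out (p := p.Prime)
  have hF : ringChar (ZMod p) ≠ 2 := by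
    rw [ZMod.ringChar_zmod_n]
    rintro rfl
    exact absurd hodd (by decide)
  have hc := V32.card_curve hF
  rw [ZMod.card] at hc
  have ha : a2 = - V32.S (-1 : ZMod p) := by rw [ha2, hc]; ring
  have hm := V32.card_main hF (fun x : Fin 6 → ZMod p =>
    V32.fpoly (x 0) (x 1) (x 2) (x 3) (x 4) (x 5)) (by simp [V32.fpoly])
  rw [V32.sum_tuple (fun x0 x1 x2 x3 x4 x5 =>
    quadraticChar (ZMod p) (V32.fpoly x0 x1 x2 x3 x4 x5)), V32.total hF, ZMod.card] at hm
  refine Eq.trans hm ?_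
  have hsq := FiniteField.isSquare_neg_one_iff (F := ZMod p)
  rw [ZMod.card] at hsq
  rcases Nat.odd_mod_four_iff.mp (Nat.odd_iff.mp hodd) with h | h
  · obtain ⟨i, hi⟩ := hsq.2 (by omega)
    have hi0 : i ≠ 0 := by
      rintro rfl
      simp at hi
    have h1 : quadraticChar (ZMod p) (-1) = 1 := by
      rw [hi, ← pow_two, quadraticChar_sq_one' hi0]
    have hA := V32.A_one_eq_W hF h1
    rw [V32.W_eq hF h1, ZMod.card] at hA
    have hS := V32.S_scale (1 : ZMod p) i hi0
    rw [one_mul, pow_two, ← hi] at hS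
    have hS2 : V32.S (1 : ZMod p) ^ 2 = a2 ^ 2 := by
      rw [ha, hS, neg_sq, mul_pow, pow_two (quadraticChar (ZMod p) i), V32.chi_mul_self hi0,
        one_mul]
    rw [hS2, ← ha31 h] at hA
    have hS' : V32.S (-1 : ZMod p) = -a2 := by rw [ha, neg_neg]
    rw [h1, hA, hS', ha6, ha4]
    ring
  · have h1 : quadraticChar (ZMod p) (-1) = -1 := by
      rw [quadraticChar_neg_one_iff_not_isSquare, hsq]
      simpa using h
    have hS : V32.S (-1 : ZMod p) = 0 := by
      have := V32.S_scale (-1 : ZMod p) (-1) (by simp)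
      rw [h1, neg_one_sq, mul_one] at this
      omega
    rw [hS, neg_zero] at ha
    rw [hS, ha6, ha4, ha]
    ring
end
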